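/- Fix n ≥ 3 and suppose 𝔷 is an integral domain and p(0) = A_n is invertible in 𝔷 (so K is invertible in 𝒦_p). Then every non-trivial small solution K(x) ∈ 𝒦_p(x) of the reflection equation with spectral parameter has the form K(x) = a_+(x)·K + a_0(x)·1 + a_−(x)·K⁻¹ for some rational functions a_+, a_0, a_− ∈ 𝔷(x); moreover such a non-trivial small solution can exist only when n = 3. -/

import Mathlib

noncomputable section
namespace Baxterization
open scoped TensorProduct

/-! ## The affine Hecke algebra of rank one -/

variable (k : Type) [Field k]
variable (z : Type) [CommRing z] [Algebra k z]

/-- the two generators R and K -/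
inductive G : Type | R | K

/-- The defining relations of the affine Hecke algebra of rank one:
the Hecke condition `R² = ωR + 1` and the reflection equation `RKRK = KRKR`. -/
inductive HRel (ω : z) : FreeAlgebra z G → FreeAlgebra z G → Prop
  | hecke : HRel ω (FreeAlgebra.ι z G.R * FreeAlgebra.ι z G.R)
      (ω • FreeAlgebra.ι z G.R + 1)
  | re : HRel ω (FreeAlgebra.ι z G.R * FreeAlgebra.ι z G.K * FreeAlgebra.ι z G.R *
        FreeAlgebra.ι z G.K)
      (FreeAlgebra.ι z G.K * FreeAlgebra.ι z G.R * FreeAlgebra.ι z G.K * FreeAlgebra.ι z G.R)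

/-- The affine Hecke algebra of rank one over 𝔷, with parameter ω: the quotient of the
free algebra 𝔷⟨R,K⟩ by the ideal of relations `R² = ωR + 1` and `RKRK = KRKR`. -/
def H (ω : z) : Type := RingQuot (HRel z ω)

variable (ω : z)

instance : Ring (H z ω) := inferInstanceAs (Ring (RingQuot (HRel z ω)))
instance : Algebra z (H z ω) := inferInstanceAs (Algebra z (RingQuot (HRel z ω)))
instance : Algebra k (H z ω) := inferInstanceAs (Algebra k (RingQuot (HRel z ω)))
instance : IsScalarTower k z (H z ω) :=
  inferInstanceAs (IsScalarTower k z (RingQuot (HRel z ω)))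

/-- the generator R of the affine Hecke algebra -/
def Rg : H z ω := RingQuot.mkAlgHom z (HRel z ω) (FreeAlgebra.ι z G.R)
/-- the generator K of the affine Hecke algebra -/
def Kg : H z ω := RingQuot.mkAlgHom z (HRel z ω) (FreeAlgebra.ι z G.K)
/-- Y = RKR -/
def Yg : H z ω := Rg z ω * Kg z ω * Rg z ω

/-- the elements e_{i;j} = KⁱRKʲ - KʲRKⁱ of the affine Hecke algebra -/
def eH (i j : ℕ) : H z ω :=
  Kg z ω ^ i * Rg z ω * Kg z ω ^ j - Kg z ω ^ j * Rg z ω * Kg z ω ^ i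

/-! ## The cyclotomic Hecke algebra -/

/-- the element p(K) of H, where p(u) = -u^(n+1) + A₀ uⁿ + A₁ u^(n-1) + ⋯ + Aₙ -/
def pKelt (n : ℕ) (A : ℕ → z) : H z ω :=
  - (Kg z ω) ^ (n + 1) + ∑ i ∈ Finset.range (n + 1), A i • (Kg z ω) ^ (n - i)

/-- relation generating the two-sided ideal (p(K)) of H -/
inductive CRel (n : ℕ) (A : ℕ → z) : H z ω → H z ω → Prop
  | mk : CRel n A (pKelt z ω n A) 0

/-- The cyclotomic Hecke algebra H_p: the quotient of the affine Hecke algebra H by the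
two-sided ideal generated by p(K), where p(u) = -u^(n+1) + A₀ uⁿ + ⋯ + Aₙ. -/
def Hp (n : ℕ) (A : ℕ → z) : Type := RingQuot (CRel z ω n A)

instance (n : ℕ) (A : ℕ → z) : Ring (Hp z ω n A) :=
  inferInstanceAs (Ring (RingQuot (CRel z ω n A)))
instance (n : ℕ) (A : ℕ → z) : Algebra z (Hp z ω n A) :=
  inferInstanceAs (Algebra z (RingQuot (CRel z ω n A)))
instance (n : ℕ) (A : ℕ → z) : Algebra k (Hp z ω n A) :=
  inferInstanceAs (Algebra k (RingQuot (CRel z ω n A)))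
instance (n : ℕ) (A : ℕ → z) : IsScalarTower k z (Hp z ω n A) :=
  inferInstanceAs (IsScalarTower k z (RingQuot (CRel z ω n A)))

/-- the image of R in the cyclotomic Hecke algebra -/
def Rp (n : ℕ) (A : ℕ → z) : Hp z ω n A :=
  RingQuot.mkAlgHom z (CRel z ω n A) (Rg z ω)
/-- the image of K in the cyclotomic Hecke algebra -/
def Kp (n : ℕ) (A : ℕ → z) : Hp z ω n A :=
  RingQuot.mkAlgHom z (CRel z ω n A) (Kg z ω)
/-- Y = RKR in the cyclotomic Hecke algebra -/
def Yp (n : ℕ) (A : ℕ → z) : Hp z ω n A := Rp z ω n A * Kp z ω n A * Rp z ω n A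

/-- the elements e_{i;j} = KⁱRKʲ - KʲRKⁱ of the cyclotomic Hecke algebra -/
def eHp (n : ℕ) (A : ℕ → z) (i j : ℕ) : Hp z ω n A :=
  Kp z ω n A ^ i * Rp z ω n A * Kp z ω n A ^ j -
    Kp z ω n A ^ j * Rp z ω n A * Kp z ω n A ^ i

/-- the element K̃ = Kⁿ - A₀K^(n-1) - ⋯ - A_(n-1) of the cyclotomic Hecke algebra -/
def Ktil (n : ℕ) (A : ℕ → z) : Hp z ω n A :=
  Kp z ω n A ^ n - ∑ i ∈ Finset.range n, A i • Kp z ω n A ^ (n - 1 - i)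

/-! ## Rational functions in one and two variables, and the spectral reflection equation -/

/-- polynomials in two variables x, y over the base field -/
abbrev P2 := MvPolynomial (Fin 2) k
/-- the field k(x,y) of rational functions in the two variables x, y -/
abbrev F2 := FractionRing (P2 k)

/-- auxiliary: the embedding k[X] → k(x,y), X ↦ i-th variable -/
def embP (i : Fin 2) : Polynomial k →ₐ[k] F2 k :=
  (IsScalarTower.toAlgHom k (P2 k) (F2 k)).comp (Polynomial.aeval (MvPolynomial.X i))

lemma embP_injective (i : Fin 2) : Function.Injective (embP k i) := by
  have h : ((MvPolynomial.aeval (R := k) (fun j => if j = i then Polynomial.X else 0)).comp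
      (Polynomial.aeval (R := k) (MvPolynomial.X i : P2 k))) = AlgHom.id k (Polynomial k) := by
    apply Polynomial.algHom_ext; simp
  have hinj : Function.Injective (Polynomial.aeval (R := k) (MvPolynomial.X i : P2 k)) := by
    intro a b hab
    have h2 := congrArg (MvPolynomial.aeval (R := k)
      (fun j : Fin 2 => if j = i then (Polynomial.X : Polynomial k) else 0)) hab
    have ha := congrFun (congrArg (fun (f : Polynomial k →ₐ[k] Polynomial k) =>
      (f : Polynomial k → Polynomial k)) h) a
    have hb := congrFun (congrArg (fun (f : Polynomial k →ₐ[k] Polynomial k) =>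
      (f : Polynomial k → Polynomial k)) h) b
    simp only [AlgHom.coe_comp, Function.comp_apply, AlgHom.coe_id, id_eq] at ha hb
    rw [← ha, ← hb]; exact h2
  exact (IsFractionRing.injective (P2 k) (F2 k)).comp hinj

/-- the embedding k(x) → k(x,y) sending the variable to the i-th of the two variables -/
def emb (i : Fin 2) : RatFunc k →ₐ[k] F2 k :=
  RatFunc.liftAlgHom (embP k i)
    (nonZeroDivisors_le_comap_nonZeroDivisors_of_injective _ (embP_injective k i))

/-- the first spectral variable x, as an element of k(x,y) -/
def xvar : F2 k := algebraMap (P2 k) (F2 k) (MvPolynomial.X 0)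
/-- the second spectral variable y, as an element of k(x,y) -/
def yvar : F2 k := algebraMap (P2 k) (F2 k) (MvPolynomial.X 1)

variable {B : Type} [Ring B] [Algebra k B]

/-- substitution of the spectral variable x by the i-th of the two variables x, y:
the map B(x) → B(x,y) induced by `emb i`. -/
def iota (i : Fin 2) : RatFunc k ⊗[k] B →ₐ[k] F2 k ⊗[k] B :=
  Algebra.TensorProduct.map (emb k i) (AlgHom.id k B)

/-- the baxterized R-matrix `R(t) = R - t⁻¹ R⁻¹` (note `R⁻¹ = R - ω` by the Hecke
condition), as an element of B(x,y). -/
def RxElt (ωk : k) (Relt : B) (t : F2 k) : F2 k ⊗[k] B :=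
  (1 : F2 k) ⊗ₜ[k] Relt - t⁻¹ • ((1 : F2 k) ⊗ₜ[k] (Relt - algebraMap k B ωk))

/-- `c`, viewed as an element `K(x)` of `B(x)`, satisfies the reflection equation with
spectral parameter:  `R(x/y) K(x) R(xy) K(y) = K(y) R(xy) K(x) R(x/y)` in B(x,y). -/
def IsSol (ωk : k) (Relt : B) (c : RatFunc k ⊗[k] B) : Prop :=
  RxElt k ωk Relt (xvar k / yvar k) * iota k 0 c * RxElt k ωk Relt (xvar k * yvar k) *
      iota k 1 c =
    iota k 1 c * RxElt k ωk Relt (xvar k * yvar k) * iota k 0 c *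
      RxElt k ωk Relt (xvar k / yvar k)

variable [Algebra z B]

/-- `c` lies in `𝔷(x)·1`, i.e. `c` is a scalar element of `B(x)`
(an element with trivial B-component). -/
def IsScalarElt (c : RatFunc k ⊗[k] B) : Prop :=
  c ∈ Submodule.span (RatFunc k)
    (Set.range fun a : z => (1 : RatFunc k) ⊗ₜ[k] (algebraMap z B a))

/-- the functions φ_i(ξ,x) (φ₀ = 1, φ_{i+1} = φ_i·ξx - A_i),
viewed as (central, scalar) elements of B(x). -/
def phiT (ξ : z) (A : ℕ → z) : ℕ → RatFunc k ⊗[k] B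
  | 0 => 1
  | (i + 1) => phiT ξ A i * ((RatFunc.X : RatFunc k) ⊗ₜ[k] algebraMap z B ξ)
      - (1 : RatFunc k) ⊗ₜ[k] (algebraMap z B (A i))

/-- the principal baxterized element
`K_p(ξ,ζ,x) = ∑_{i=0}^{n-1} φ_i(ξ,x) K^{n-i} + (ζ - x⁻¹ φ_n(ξ,x))/(x - x⁻¹)`,
as an element of 𝒦_p(x) ⊆ H_p(x). -/
def KxMain (n : ℕ) (A : ℕ → z) (ξ ζ : z) : RatFunc k ⊗[k] Hp z ω n A :=
  (∑ i ∈ Finset.range n,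
      phiT k z (B := Hp z ω n A) ξ A i * ((1 : RatFunc k) ⊗ₜ[k] (Kp z ω n A) ^ (n - i))) +
    ((RatFunc.X - RatFunc.X⁻¹)⁻¹ : RatFunc k) •
      ((1 : RatFunc k) ⊗ₜ[k] algebraMap z (Hp z ω n A) ζ -
        (RatFunc.X⁻¹ : RatFunc k) • phiT k z (B := Hp z ω n A) ξ A n)

/-- the scalar function ψ(ξ,ζ,x) = (-ξⁿx^{n+1} + ∑_{i=0}^{n-1} A_i ξ^{n-1-i} x^{n-i} + ζ)/(x-x⁻¹),
viewed as a (scalar) element of H_p(x). -/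
def psiT (n : ℕ) (A : ℕ → z) (ξ ζ : z) : RatFunc k ⊗[k] Hp z ω n A :=
  ((RatFunc.X - RatFunc.X⁻¹)⁻¹ : RatFunc k) •
    (((∑ i ∈ Finset.range n,
        (RatFunc.X ^ (n - i) : RatFunc k) ⊗ₜ[k]
          algebraMap z (Hp z ω n A) (A i * ξ ^ (n - 1 - i))) +
      (1 : RatFunc k) ⊗ₜ[k] algebraMap z (Hp z ω n A) ζ) -
      ((RatFunc.X ^ (n + 1) : RatFunc k) ⊗ₜ[k] algebraMap z (Hp z ω n A) (ξ ^ n)))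

/-- An element of 𝒦_p(x) is a *principal* solution if n = 1, or if n > 1 and the
coefficient of K^(n-1) in its expansion over the basis {1, K, …, K^(n-1), K̃} of 𝒦_p,
where K̃ = Kⁿ - A₀K^(n-1) - ⋯ - A_(n-1), is non-zero. -/
def IsPrincipal (n : ℕ) (A : ℕ → z) (c : RatFunc k ⊗[k] Hp z ω n A) : Prop :=
  n = 1 ∨ (1 < n ∧ ∃ f : ℕ → RatFunc k ⊗[k] Hp z ω n A,
    (∀ i, IsScalarElt k z (B := Hp z ω n A) (f i)) ∧
    c = (∑ i ∈ Finset.range n, f i * ((1 : RatFunc k) ⊗ₜ[k] (Kp z ω n A) ^ i)) +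
        f n * ((1 : RatFunc k) ⊗ₜ[k] Ktil z ω n A) ∧
    f (n - 1) ≠ 0)

/-! ## Commutative auxiliaries: the polynomial p, the functions φ and the coefficients A⁽ᵐ⁾ -/

/-- the polynomial p(u) = -u^(n+1) + A₀ uⁿ + ⋯ + Aₙ -/
def pPoly (n : ℕ) (A : ℕ → z) : Polynomial z :=
  - Polynomial.X ^ (n + 1) +
    ∑ i ∈ Finset.range (n + 1), Polynomial.C (A i) * Polynomial.X ^ (n - i)

/-- the polynomials φ_i(ξ,x) ∈ 𝔷[x]: φ₀ = 1, φ_{i+1} = φ_i·ξx - A_i -/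
def phiP (A : ℕ → z) (ξ : z) : ℕ → Polynomial z
  | 0 => 1
  | (i + 1) => phiP A ξ i * (Polynomial.C ξ * Polynomial.X) - Polynomial.C (A i)

/-- the monic polynomial u^(n+1) - A₀uⁿ - ⋯ - Aₙ (i.e. -p(u)) -/
def qPoly (n : ℕ) (A : ℕ → z) : Polynomial z :=
  Polynomial.X ^ (n + 1) -
    ∑ i ∈ Finset.range (n + 1), Polynomial.C (A i) * Polynomial.X ^ (n - i)

/-- the coefficients A⁽ᵐ⁾_i ∈ 𝔷 defined by uᵐ ≡ ∑_{i=0}^n A⁽ᵐ⁾_i u^{n-i}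
modulo the monic polynomial u^(n+1) - A₀uⁿ - ⋯ - Aₙ -/
def Am (n : ℕ) (A : ℕ → z) (m i : ℕ) : z :=
  ((Polynomial.X : Polynomial z) ^ m %ₘ qPoly z n A).coeff (n - i)

/-- polynomials in two variables over 𝔷 -/
abbrev ZP2 := MvPolynomial (Fin 2) z

/-- the embedding 𝔷[u] → 𝔷[x,y] sending u to the i-th variable -/
def evP (i : Fin 2) : Polynomial z →ₐ[z] ZP2 z := Polynomial.aeval (MvPolynomial.X i)

/-- The subalgebra 𝒦_p(x) of H_p(x): rational functions of x with values in the
subalgebra 𝒦_p ⊆ H_p generated by K (over 𝔷). -/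
def KpX (n : ℕ) (A : ℕ → z) : Subalgebra (RatFunc k) (RatFunc k ⊗[k] Hp z ω n A) :=
  Algebra.adjoin (RatFunc k)
    ({(1 : RatFunc k) ⊗ₜ[k] Kp z ω n A} ∪
      Set.range (fun a : z => (1 : RatFunc k) ⊗ₜ[k] algebraMap z (Hp z ω n A) a))


/-- K⁻¹ = Aₙ⁻¹(Kⁿ − A₀K^{n−1} − ⋯ − A_{n−1}) in the cyclotomic Hecke algebra,
where η = Aₙ⁻¹. -/
def KinvN (n : ℕ) (A : ℕ → z) (eta : z) : Hp z ω n A :=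
  algebraMap z (Hp z ω n A) eta *
    (Kp z ω n A ^ n -
      ∑ i ∈ Finset.range n, algebraMap z (Hp z ω n A) (A i) * Kp z ω n A ^ (n - 1 - i))

section PolynomialRepresentation

variable {W : Type} [Field W]

/-- the automorphism of `W[u,v]` exchanging the two variables -/
def swapVars : MvPolynomial (Fin 2) W →ₐ[W] MvPolynomial (Fin 2) W :=
  MvPolynomial.rename (Equiv.swap 0 1)

lemma swapVars_X_zero :
    swapVars (MvPolynomial.X 0 : MvPolynomial (Fin 2) W) = MvPolynomial.X 1 := by
  simp [swapVars]

lemma swapVars_X_one :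
    swapVars (MvPolynomial.X 1 : MvPolynomial (Fin 2) W) = MvPolynomial.X 0 := by
  simp [swapVars]

lemma swapVars_swapVars (f : MvPolynomial (Fin 2) W) : swapVars (swapVars f) = f := by
  have h : (swapVars.comp swapVars : MvPolynomial (Fin 2) W →ₐ[W] _) = AlgHom.id W _ := by
    apply MvPolynomial.algHom_ext
    intro i
    fin_cases i <;> simp [swapVars]
  exact DFunLike.congr_fun h f

lemma exists_dividedDiff (f : MvPolynomial (Fin 2) W) :
    ∃ g, (MvPolynomial.X 0 - MvPolynomial.X 1) * g = f - swapVars f := by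
  induction f using MvPolynomial.induction_on with
  | C a => exact ⟨0, by simp [swapVars]⟩
  | add f₁ f₂ h₁ h₂ =>
    obtain ⟨g₁, h₁⟩ := h₁
    obtain ⟨g₂, h₂⟩ := h₂
    exact ⟨g₁ + g₂, by rw [mul_add, h₁, h₂, map_add]; ring⟩
  | mul_X f i h =>
    obtain ⟨g, h⟩ := h
    fin_cases i
    · refine ⟨g * MvPolynomial.X 0 + swapVars f, ?_⟩
      simp only [Fin.zero_eta, Fin.isValue, map_mul, swapVars_X_zero]
      linear_combination MvPolynomial.X 0 * h
    · refine ⟨g * MvPolynomial.X 1 - swapVars f, ?_⟩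
      simp only [Fin.mk_one, Fin.isValue, map_mul, swapVars_X_one]
      linear_combination MvPolynomial.X 1 * h

lemma X_zero_sub_X_one_ne_zero :
    (MvPolynomial.X 0 - MvPolynomial.X 1 : MvPolynomial (Fin 2) W) ≠ 0 :=
  sub_ne_zero.2 fun h => absurd (MvPolynomial.X_injective h) (by decide)

/-- the divided difference `(f(u,v) - f(v,u)) / (u - v)` -/
def dividedDiff : MvPolynomial (Fin 2) W →ₗ[W] MvPolynomial (Fin 2) W where
  toFun f := (exists_dividedDiff f).choose
  map_add' f g := by
    apply mul_left_cancel₀ X_zero_sub_X_one_ne_zero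
    rw [mul_add, (exists_dividedDiff _).choose_spec, (exists_dividedDiff _).choose_spec,
      (exists_dividedDiff _).choose_spec, map_add]
    ring
  map_smul' a f := by
    apply mul_left_cancel₀ X_zero_sub_X_one_ne_zero
    rw [RingHom.id_apply, mul_smul_comm, (exists_dividedDiff _).choose_spec,
      (exists_dividedDiff _).choose_spec, map_smul, smul_sub]

lemma mul_dividedDiff (f : MvPolynomial (Fin 2) W) :
    (MvPolynomial.X 0 - MvPolynomial.X 1) * dividedDiff f = f - swapVars f :=
  (exists_dividedDiff f).choose_spec

lemma dividedDiff_eq_iff {f g : MvPolynomial (Fin 2) W} :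
    dividedDiff f = g ↔ (MvPolynomial.X 0 - MvPolynomial.X 1) * g = f - swapVars f := by
  rw [← mul_dividedDiff, mul_right_inj' X_zero_sub_X_one_ne_zero, eq_comm]

lemma swapVars_dividedDiff (f : MvPolynomial (Fin 2) W) :
    swapVars (dividedDiff f) = dividedDiff f := by
  symm
  rw [dividedDiff_eq_iff]
  have h := congrArg swapVars (mul_dividedDiff f)
  simp only [map_mul, map_sub, swapVars_X_zero, swapVars_X_one, swapVars_swapVars] at h
  linear_combination -h

/-- The Demazure–Lusztig operator `f ↦ q f(v,u) - (q - q⁻¹) v (f(u,v) - f(v,u)) / (u - v)`. -/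
def demazureLusztig (q : W) :
    MvPolynomial (Fin 2) W →ₗ[W] MvPolynomial (Fin 2) W :=
  q • swapVars.toLinearMap -
    (q - q⁻¹) • (LinearMap.mulLeft W (MvPolynomial.X 1) ∘ₗ dividedDiff)

lemma demazureLusztig_apply (q : W) (f : MvPolynomial (Fin 2) W) :
    demazureLusztig q f = MvPolynomial.C q * swapVars f -
      (MvPolynomial.C q - MvPolynomial.C q⁻¹) * (MvPolynomial.X 1 * dividedDiff f) := by
  simp [demazureLusztig, MvPolynomial.smul_eq_C_mul]

lemma C_mul_C_inv {q : W} (hq : q ≠ 0) :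
    (MvPolynomial.C q * MvPolynomial.C q⁻¹ : MvPolynomial (Fin 2) W) = 1 := by
  rw [← MvPolynomial.C_mul, mul_inv_cancel₀ hq, MvPolynomial.C_1]

lemma swapVars_C (a : W) :
    swapVars (MvPolynomial.C a : MvPolynomial (Fin 2) W) = MvPolynomial.C a := by
  simp [swapVars]

lemma swapVars_demazureLusztig (q : W) (f : MvPolynomial (Fin 2) W) :
    swapVars (demazureLusztig q f) = MvPolynomial.C q * f -
      (MvPolynomial.C q - MvPolynomial.C q⁻¹) * (MvPolynomial.X 0 * dividedDiff f) := by
  simp only [demazureLusztig_apply, map_sub, map_mul, swapVars_C, swapVars_swapVars,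
    swapVars_X_one, swapVars_dividedDiff]

lemma dividedDiff_demazureLusztig (q : W) (f : MvPolynomial (Fin 2) W) :
    dividedDiff (demazureLusztig q f) = -(MvPolynomial.C q⁻¹ * dividedDiff f) := by
  rw [dividedDiff_eq_iff, swapVars_demazureLusztig, demazureLusztig_apply]
  linear_combination - MvPolynomial.C q * mul_dividedDiff f

lemma demazureLusztig_mul (q : W) (f g : MvPolynomial (Fin 2) W) :
    demazureLusztig q (f * g) = swapVars f * demazureLusztig q g -
      (MvPolynomial.C q - MvPolynomial.C q⁻¹) * MvPolynomial.X 1 * dividedDiff f * g := by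
  have h : dividedDiff (f * g) = swapVars f * dividedDiff g + dividedDiff f * g := by
    rw [dividedDiff_eq_iff, map_mul]
    linear_combination swapVars f * mul_dividedDiff g + g * mul_dividedDiff f
  rw [demazureLusztig_apply, h, demazureLusztig_apply, map_mul]
  ring

lemma demazureLusztig_sq {q : W} (hq : q ≠ 0) (f : MvPolynomial (Fin 2) W) :
    demazureLusztig q (demazureLusztig q f) =
      (MvPolynomial.C q - MvPolynomial.C q⁻¹) * demazureLusztig q f + f := by
  rw [demazureLusztig_apply q (demazureLusztig q f), swapVars_demazureLusztig,
    dividedDiff_demazureLusztig, demazureLusztig_apply]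
  linear_combination f * C_mul_C_inv hq -
    MvPolynomial.C q * (MvPolynomial.C q - MvPolynomial.C q⁻¹) * mul_dividedDiff f

lemma demazureLusztig_X_mul_demazureLusztig {q : W} (hq : q ≠ 0) (f : MvPolynomial (Fin 2) W) :
    demazureLusztig q (MvPolynomial.X 0 * demazureLusztig q f) = MvPolynomial.X 1 * f := by
  have h : dividedDiff (MvPolynomial.X 0 : MvPolynomial (Fin 2) W) = 1 := by
    rw [dividedDiff_eq_iff, swapVars_X_zero, mul_one]
  rw [demazureLusztig_mul, swapVars_X_zero, h, demazureLusztig_sq hq]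
  ring

lemma demazureLusztig_X_mul (q : W) (f : MvPolynomial (Fin 2) W) :
    demazureLusztig q (MvPolynomial.X 0 * f) = MvPolynomial.X 1 *
      (demazureLusztig q f - (MvPolynomial.C q - MvPolynomial.C q⁻¹) * f) := by
  have h : dividedDiff (MvPolynomial.X 0 : MvPolynomial (Fin 2) W) = 1 := by
    rw [dividedDiff_eq_iff, swapVars_X_zero, mul_one]
  rw [demazureLusztig_mul, swapVars_X_zero, h]
  ring

lemma demazureLusztig_one (q : W) : demazureLusztig q 1 = MvPolynomial.C q := by
  have h : dividedDiff (1 : MvPolynomial (Fin 2) W) = 0 := by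
    rw [dividedDiff_eq_iff, map_one]; ring
  rw [demazureLusztig_apply, h, map_one]
  ring

/-- the polynomial `P(u)` in the first of the two variables -/
def inFirstVar (P : Polynomial W) : MvPolynomial (Fin 2) W :=
  Polynomial.aeval (MvPolynomial.X 0) P

/-- the ideal generated by `P(u)` and its image under the Demazure–Lusztig operator -/
def cyclotomicIdeal (q : W) (P : Polynomial W) : Ideal (MvPolynomial (Fin 2) W) :=
  Ideal.span {inFirstVar P, demazureLusztig q (inFirstVar P)}

lemma demazureLusztig_mem_cyclotomicIdeal {q : W} (hq : q ≠ 0) (P : Polynomial W)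
    {f : MvPolynomial (Fin 2) W} (hf : f ∈ cyclotomicIdeal q P) :
    demazureLusztig q f ∈ cyclotomicIdeal q P := by
  have h₁ : inFirstVar P ∈ cyclotomicIdeal q P := Ideal.subset_span (by simp)
  have h₂ : demazureLusztig q (inFirstVar P) ∈ cyclotomicIdeal q P :=
    Ideal.subset_span (by simp)
  obtain ⟨a, b, rfl⟩ := Ideal.mem_span_pair.1 hf
  rw [map_add, demazureLusztig_mul, demazureLusztig_mul, demazureLusztig_sq hq]
  refine add_mem (sub_mem (Ideal.mul_mem_left _ _ h₂) (Ideal.mul_mem_left _ _ h₁))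
    (sub_mem (Ideal.mul_mem_left _ _ (add_mem (Ideal.mul_mem_left _ _ h₂) h₁))
      (Ideal.mul_mem_left _ _ h₂))

/-- The quotient of the polynomial representation by the cyclotomic ideal. -/
abbrev CycRep (q : W) (P : Polynomial W) : Type :=
  MvPolynomial (Fin 2) W ⧸ cyclotomicIdeal q P

/-- the operator induced by the Demazure–Lusztig operator on the cyclotomic quotient -/
def cycR {q : W} (hq : q ≠ 0) (P : Polynomial W) :
    Module.End W (CycRep q P) :=
  ((cyclotomicIdeal q P).restrictScalars W).mapQ ((cyclotomicIdeal q P).restrictScalars W)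
    (demazureLusztig q) fun _ hf => demazureLusztig_mem_cyclotomicIdeal hq P hf

lemma cycR_mk {q : W} (hq : q ≠ 0) (P : Polynomial W) (f : MvPolynomial (Fin 2) W) :
    cycR hq P (Ideal.Quotient.mk _ f) = Ideal.Quotient.mk _ (demazureLusztig q f) := rfl

/-- the ring homomorphism from `W[u]/(P)` to the cyclotomic quotient -/
def cycHom (q : W) (P : Polynomial W) : AdjoinRoot P →ₐ[W] CycRep q P :=
  AdjoinRoot.liftAlgHom P (Algebra.ofId W _) (Ideal.Quotient.mk _ (MvPolynomial.X 0)) (by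
    have h : inFirstVar P ∈ cyclotomicIdeal q P := Ideal.subset_span (by simp)
    rw [← Ideal.Quotient.eq_zero_iff_mem, inFirstVar, ← Ideal.Quotient.mkₐ_eq_mk W,
      ← Polynomial.aeval_algHom_apply] at h
    exact h)

open Polynomial TensorProduct

lemma eq_zero_of_sum_triangular {A : Type} [CommRing A] {ψ : ℕ → A[X]}
    (hdeg : ∀ j, (ψ j).natDegree ≤ j) (hunit : ∀ j, IsUnit ((ψ j).coeff j)) (c : ℕ → A) (N : ℕ)
    (h : ∑ j ∈ Finset.range N, C (c j) * ψ j = 0) : ∀ j < N, c j = 0 := by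
  induction N with
  | zero => simp
  | succ N ih =>
    have hN : c N = 0 := by
      have h' := congrArg (fun f => f.coeff N) h
      rw [Finset.sum_range_succ, coeff_add, finsetSum_coeff, coeff_C_mul, coeff_zero,
        Finset.sum_eq_zero, zero_add] at h'
      · exact (hunit N).mul_left_eq_zero.1 h'
      · intro j hj
        rw [coeff_C_mul, coeff_eq_zero_of_natDegree_lt
          ((hdeg j).trans_lt (Finset.mem_range.1 hj)), mul_zero]
    rw [Finset.sum_range_succ, hN, C_0, zero_mul, add_zero] at h
    intro j hj
    rcases Nat.lt_succ_iff_lt_or_eq.1 hj with hj | rfl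
    · exact ih h j hj
    · exact hN

/-- the evaluation homomorphism `W[u,v] → (W[u]/(P))[v]` -/
def evalCyc (P : W[X]) : MvPolynomial (Fin 2) W →ₐ[W] (AdjoinRoot P)[X] :=
  MvPolynomial.aeval ![C (AdjoinRoot.root P), X]

lemma evalCyc_X_zero (P : W[X]) : evalCyc P (MvPolynomial.X 0) = C (AdjoinRoot.root P) := by
  simp [evalCyc]

lemma evalCyc_X_one (P : W[X]) : evalCyc P (MvPolynomial.X 1) = X := by
  simp [evalCyc]

lemma evalCyc_C (P : W[X]) (a : W) : evalCyc P (MvPolynomial.C a) = C (algebraMap W _ a) := by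
  simp [evalCyc]

lemma evalCyc_inFirstVar (P Q : W[X]) :
    evalCyc P (inFirstVar Q) = C (AdjoinRoot.mk P Q) := by
  rw [inFirstVar, ← aeval_algHom_apply, evalCyc_X_zero, ← AdjoinRoot.aeval_eq]
  exact aeval_algHom_apply (CAlgHom (R := W) (A := AdjoinRoot P)) _ Q

/-- the image in `(W[u]/(P))[v]` of `uʲ` under the Demazure–Lusztig operator -/
def dlPower (q : W) (P : W[X]) (j : ℕ) : (AdjoinRoot P)[X] :=
  evalCyc P (demazureLusztig q (MvPolynomial.X 0 ^ j))

lemma dlPower_zero (q : W) (P : W[X]) : dlPower q P 0 = C (algebraMap W _ q) := by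
  rw [dlPower, pow_zero, demazureLusztig_one, evalCyc_C]

lemma dlPower_succ (q : W) (P : W[X]) (j : ℕ) :
    dlPower q P (j + 1) = X *
      (dlPower q P j - C (algebraMap W _ (q - q⁻¹) * AdjoinRoot.root P ^ j)) := by
  rw [dlPower, pow_succ', demazureLusztig_X_mul, ← MvPolynomial.C_sub]
  simp only [map_mul (evalCyc P), map_sub (evalCyc P), map_pow (evalCyc P), evalCyc_X_zero,
    evalCyc_X_one, evalCyc_C, dlPower, C_mul, C_pow]

lemma natDegree_dlPower_le (q : W) (P : W[X]) (j : ℕ) : (dlPower q P j).natDegree ≤ j := by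
  induction j with
  | zero => rw [dlPower_zero, natDegree_C]
  | succ j ih =>
    rw [dlPower_succ, add_comm]
    refine natDegree_mul_le_of_le natDegree_X_le ((natDegree_sub_le _ _).trans (max_le ih ?_))
    exact (natDegree_C _).le.trans (Nat.zero_le _)

lemma coeff_dlPower_succ (q : W) (P : W[X]) (j : ℕ) :
    (dlPower q P (j + 1)).coeff (j + 1) = algebraMap W _ q⁻¹ := by
  induction j with
  | zero => rw [dlPower_succ, coeff_X_mul, dlPower_zero]; simp
  | succ j ih => rw [dlPower_succ, coeff_X_mul, coeff_sub, ih, coeff_C_succ, sub_zero]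

lemma isUnit_coeff_dlPower {q : W} (hq : q ≠ 0) (P : W[X]) (j : ℕ) :
    IsUnit ((dlPower q P j).coeff j) := by
  cases j with
  | zero => rw [dlPower_zero, coeff_C_zero]; exact (IsUnit.mk0 q hq).map _
  | succ j => rw [coeff_dlPower_succ]; exact (IsUnit.mk0 _ (inv_ne_zero hq)).map _

lemma evalCyc_demazureLusztig_inFirstVar (q : W) (P Q : W[X]) :
    evalCyc P (demazureLusztig q (inFirstVar Q)) =
      ∑ j ∈ Finset.range (Q.natDegree + 1), C (algebraMap W _ (Q.coeff j)) * dlPower q P j := by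
  rw [inFirstVar, aeval_eq_sum_range, map_sum, map_sum]
  refine Finset.sum_congr rfl fun j _ => ?_
  rw [map_smul, map_smul, dlPower, Algebra.smul_def]
  rfl

/-- an associate of the second generator of the cyclotomic ideal, seen in `(W[u]/(P))[v]`,
which is monic when `P` is -/
def cycRelation (q : W) (P : W[X]) : (AdjoinRoot P)[X] :=
  C (algebraMap W _ q) * evalCyc P (demazureLusztig q (inFirstVar P))

lemma natDegree_cycRelation_le (q : W) (P : W[X]) :
    (cycRelation q P).natDegree ≤ P.natDegree := by
  refine (natDegree_C_mul_le _ _).trans ?_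
  rw [evalCyc_demazureLusztig_inFirstVar]
  refine natDegree_sum_le_of_forall_le _ _ fun j hj => (natDegree_C_mul_le _ _).trans ?_
  exact (natDegree_dlPower_le q P j).trans (Nat.lt_succ_iff.1 (Finset.mem_range.1 hj))

lemma coeff_cycRelation {q : W} (hq : q ≠ 0) {P : W[X]} (hP : P.Monic) {n : ℕ}
    (hn : P.natDegree = n + 1) : (cycRelation q P).coeff (n + 1) = 1 := by
  rw [cycRelation, coeff_C_mul, evalCyc_demazureLusztig_inFirstVar, hn, Finset.sum_range_succ,
    coeff_add, finsetSum_coeff, Finset.sum_eq_zero, coeff_C_mul, coeff_dlPower_succ, ← hn,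
    hP.coeff_natDegree, map_one, one_mul, zero_add, ← map_mul, mul_inv_cancel₀ hq, map_one]
  intro j hj
  rw [coeff_C_mul, coeff_eq_zero_of_natDegree_lt (p := dlPower q P j)
    ((natDegree_dlPower_le q P j).trans_lt (Finset.mem_range.1 hj)), mul_zero]

lemma cycRelation_dvd_of_mem {q : W} (hq : q ≠ 0) {P : W[X]} {f : MvPolynomial (Fin 2) W}
    (hf : f ∈ cyclotomicIdeal q P) : cycRelation q P ∣ evalCyc P f := by
  obtain ⟨a, b, rfl⟩ := Ideal.mem_span_pair.1 hf
  rw [map_add, map_mul, map_mul, evalCyc_inFirstVar, AdjoinRoot.mk_self, C_0, mul_zero, zero_add]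
  refine Dvd.dvd.mul_left ?_ _
  rw [cycRelation]
  have h : IsUnit (C (algebraMap W (AdjoinRoot P) q)) :=
    ((IsUnit.mk0 q hq).map (algebraMap W (AdjoinRoot P))).map C
  exact h.mul_left_dvd.2 dvd_rfl

lemma cycHom_mk (q : W) (P Q : W[X]) :
    cycHom q P (AdjoinRoot.mk P Q) = Ideal.Quotient.mk _ (inFirstVar Q) := by
  rw [inFirstVar, ← Ideal.Quotient.mkₐ_eq_mk W, ← aeval_algHom_apply]
  rfl

/-- the linear map `a ⊗ b ↦ a R b · 1` -/
def sandwich {q : W} (hq : q ≠ 0) (P : W[X]) :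
    AdjoinRoot P ⊗[W] AdjoinRoot P →ₗ[W] CycRep q P :=
  TensorProduct.lift (((LinearMap.mul W (CycRep q P)).compl₁₂ (cycHom q P).toLinearMap
    (cycR hq P ∘ₗ (cycHom q P).toLinearMap)))

lemma sandwich_tmul {q : W} (hq : q ≠ 0) (P : W[X]) (a b : AdjoinRoot P) :
    sandwich hq P (a ⊗ₜ b) = cycHom q P a * cycR hq P (cycHom q P b) := rfl

lemma sandwich_injective {q : W} (hq : q ≠ 0) {P : W[X]} (hP : P.Monic) {n : ℕ}
    (hn : P.natDegree = n + 1) : Function.Injective (sandwich hq P) := by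
  rw [injective_iff_map_eq_zero]
  intro t ht
  obtain ⟨b, rfl⟩ := TensorProduct.eq_repr_basis_right (AdjoinRoot.powerBasis' hP).basis t
  choose Q hQ using fun i => AdjoinRoot.mk_surjective (b i)
  rw [Finsupp.sum_fintype _ _ (by simp)] at ht ⊢
  have hdim : (AdjoinRoot.powerBasis' hP).dim = n + 1 := by simp [hn]
  have hmem : ∑ i, inFirstVar (Q i) * demazureLusztig q (MvPolynomial.X 0 ^ (i : ℕ)) ∈
      cyclotomicIdeal q P := by
    rw [← Ideal.Quotient.eq_zero_iff_mem, ← ht, map_sum, map_sum]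
    refine Finset.sum_congr rfl fun i _ => ?_
    rw [sandwich_tmul, ← hQ, cycHom_mk, map_mul, PowerBasis.basis_eq_pow,
      AdjoinRoot.powerBasis'_gen, ← AdjoinRoot.mk_X, ← map_pow, cycHom_mk, cycR_mk]
    simp [inFirstVar]
  have hdvd := cycRelation_dvd_of_mem hq hmem
  have hsum : evalCyc P (∑ i, inFirstVar (Q i) * demazureLusztig q (MvPolynomial.X 0 ^ (i : ℕ))) =
      ∑ i, C (b i) * dlPower q P i := by
    rw [map_sum]
    refine Finset.sum_congr rfl fun i _ => ?_
    rw [map_mul, evalCyc_inFirstVar, hQ, dlPower]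
  have : Nontrivial (AdjoinRoot P) := AdjoinRoot.nontrivial P (by
    rw [degree_eq_natDegree hP.ne_zero, hn]; exact_mod_cast Nat.succ_ne_zero n)
  have hdeg : (cycRelation q P).natDegree = n + 1 :=
    le_antisymm (hn ▸ natDegree_cycRelation_le q P)
      (le_natDegree_of_ne_zero (by rw [coeff_cycRelation hq hP hn]; exact one_ne_zero))
  have hmonic : (cycRelation q P).Monic := by
    rw [Monic, leadingCoeff, hdeg, coeff_cycRelation hq hP hn]
  have hzero : ∑ i, C (b i) * dlPower q P i = 0 := by
    rw [hsum] at hdvd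
    by_contra hne
    refine hmonic.not_dvd_of_natDegree_lt hne ?_ hdvd
    rw [hdeg, Nat.lt_succ_iff]
    refine natDegree_sum_le_of_forall_le _ _ fun i _ => (natDegree_C_mul_le _ _).trans ?_
    exact (natDegree_dlPower_le q P i).trans (by have := i.2; omega)
  have hb : ∀ i, b i = 0 := by
    intro i
    have := eq_zero_of_sum_triangular (natDegree_dlPower_le q P) (isUnit_coeff_dlPower hq P)
      (fun j => if h : j < (AdjoinRoot.powerBasis' hP).dim then b ⟨j, h⟩ else 0)
      (AdjoinRoot.powerBasis' hP).dim (by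
        rw [← hzero, Finset.sum_range]
        exact Finset.sum_congr rfl fun i _ => by rw [dif_pos i.2]) i i.2
    rwa [dif_pos i.2] at this
  exact Finset.sum_eq_zero fun i _ => by rw [hb, TensorProduct.zero_tmul]

lemma cycR_cycR {q : W} (hq : q ≠ 0) (P : W[X]) (x : CycRep q P) :
    cycR hq P (cycR hq P x) = (q - q⁻¹) • cycR hq P x + x := by
  obtain ⟨f, rfl⟩ := Ideal.Quotient.mk_surjective x
  rw [cycR_mk, cycR_mk, demazureLusztig_sq hq, map_add, ← MvPolynomial.C_sub,
    ← MvPolynomial.smul_eq_C_mul]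
  rfl

lemma cycR_root_mul_cycR {q : W} (hq : q ≠ 0) (P : W[X]) (x : CycRep q P) :
    cycR hq P (cycHom q P (AdjoinRoot.root P) * cycR hq P x) =
      Ideal.Quotient.mk _ (MvPolynomial.X 1) * x := by
  obtain ⟨f, rfl⟩ := Ideal.Quotient.mk_surjective x
  rw [← AdjoinRoot.mk_X, cycHom_mk, cycR_mk, ← map_mul, cycR_mk, inFirstVar, aeval_X,
    demazureLusztig_X_mul_demazureLusztig hq, map_mul]

/-- the action of `W[u]/(P)` on the cyclotomic quotient by multiplication -/
def cycMul (q : W) (P : W[X]) : AdjoinRoot P →ₐ[W] Module.End W (CycRep q P) :=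
  (Algebra.lmul W (CycRep q P)).comp (cycHom q P)

lemma cycMul_apply (q : W) (P : W[X]) (a : AdjoinRoot P) (x : CycRep q P) :
    cycMul q P a x = cycHom q P a * x := rfl

lemma cycR_mul_root_mul_cycR_apply {q : W} (hq : q ≠ 0) (P : W[X]) (x : CycRep q P) :
    (cycR hq P * cycMul q P (AdjoinRoot.root P) * cycR hq P) x =
      Ideal.Quotient.mk _ (MvPolynomial.X 1) * x :=
  cycR_root_mul_cycR hq P x

/-- A representation of the cyclotomic Hecke algebra over a field in which the elements
`Kⁱ R Kʲ` are linearly independent. -/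
theorem exists_cyclotomic_representation {q : W} (hq : q ≠ 0) {P : W[X]} (hP : P.Monic) {n : ℕ}
    (hn : P.natDegree = n + 1) :
    ∃ (E : Type) (_ : Ring E) (_ : Algebra W E) (R : E) (j : AdjoinRoot P →ₐ[W] E),
      R * R = (q - q⁻¹) • R + 1 ∧
      (∀ c, Commute (j c) (R * j (AdjoinRoot.root P) * R)) ∧
      ∀ l l' : AdjoinRoot P →ₗ[W] W, ∃ D : E →ₗ[W] W, ∀ a b, D (j a * R * j b) = l a * l' b := by
  refine ⟨Module.End W (CycRep q P), inferInstance, inferInstance, cycR hq P, cycMul q P,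
    LinearMap.ext fun x => cycR_cycR hq P x, fun c => LinearMap.ext fun x => ?_, fun l l' => ?_⟩
  · rw [Module.End.mul_apply (cycMul q P c), Module.End.mul_apply _ (cycMul q P c),
    cycR_mul_root_mul_cycR_apply,
      cycR_mul_root_mul_cycR_apply, cycMul_apply, cycMul_apply, mul_left_comm]
  · obtain ⟨g, hg⟩ := (sandwich hq P).exists_leftInverse_of_injective
      (LinearMap.ker_eq_bot.2 (sandwich_injective hq hP hn))
    refine ⟨(LinearMap.mul' W W ∘ₗ TensorProduct.map l l') ∘ₗ g ∘ₗ LinearMap.applyₗ 1, ?_⟩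
    intro a b
    have h : (cycMul q P a * cycR hq P * cycMul q P b) 1 = sandwich hq P (a ⊗ₜ b) := by
      rw [Module.End.mul_apply, Module.End.mul_apply, cycMul_apply, cycMul_apply, mul_one,
        sandwich_tmul]
    rw [LinearMap.comp_apply, LinearMap.comp_apply g, LinearMap.applyₗ_apply_apply, h,
      ← LinearMap.comp_apply g, hg]
    rfl

end PolynomialRepresentation

section CommutatorIdentities

variable {W E : Type} [Field W] [Ring E] [Algebra W E] {R x x' g h : E} {w : W}

lemma mul_eq_of_hecke (hR : R * R = w • R + 1) (x : E) :
    R * x = R * x * R * R - w • (R * x * R) := by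
  rw [mul_assoc (R * x), hR, mul_add, mul_one, mul_smul_comm, add_sub_cancel_left]

lemma mul_commutator (hR : R * R = w • R + 1) (hx : Commute x g) (hY : Commute (R * x * R) g) :
    R * x * R * (R * g - g * R) = (R * g - g * R) * x := by
  have hR' : R * x * R * R = R * x + w • (R * x * R) :=
    sub_eq_iff_eq_add.1 (mul_eq_of_hecke hR x).symm
  have h₁ : R * x * R * (g * R) = g * (R * x + w • (R * x * R)) := by
    rw [← mul_assoc, hY.eq, mul_assoc, hR']
  have h₂ : R * x * R * (R * g) = (R * x + w • (R * x * R)) * g := by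
    rw [← mul_assoc, hR']
  rw [mul_sub, h₁, h₂, add_mul, mul_add, smul_mul_assoc, mul_smul_comm, hY.eq,
    add_sub_add_right_eq_sub, sub_mul, mul_assoc R x, hx.eq]
  noncomm_ring

lemma commutator_mul_left (hR : R * R = w • R + 1) (hY : Commute (R * x * R) g)
    (hh : Commute h g) :
    R * (x * h) * R * g - g * (R * (x * h) * R) =
      R * x * R * (R * h * R * g - g * (R * h * R)) -
        w • (R * x * R * (h * (R * g - g * R))) := by
  set Y := R * x * R with hYdef
  have hRx : R * x = Y * R - w • Y := mul_eq_of_hecke hR x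
  rw [← mul_assoc R x h, hRx]
  have h₁ : g * ((Y * R - w • Y) * h * R) = Y * (g * (R * h * R)) - w • (Y * (h * (g * R))) := by
    rw [← mul_assoc h g, hh.eq, sub_mul, sub_mul, mul_sub, smul_mul_assoc, smul_mul_assoc,
      mul_smul_comm, ← mul_assoc Y g, hY.eq, ← mul_assoc Y (g * h), ← mul_assoc Y g, hY.eq]
    noncomm_ring
  rw [h₁, sub_mul, sub_mul, sub_mul, smul_mul_assoc, smul_mul_assoc, smul_mul_assoc,
    mul_sub Y, mul_sub h, mul_sub Y, smul_sub]
  noncomm_ring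

lemma commutator_one (hR : R * R = w • R + 1) (g : E) :
    R * 1 * R * g - g * (R * 1 * R) = w • (R * g - g * R) := by
  rw [mul_one, hR, add_mul, mul_add, smul_mul_assoc, mul_smul_comm, smul_sub, one_mul, mul_one,
    add_sub_add_right_eq_sub]

lemma commutator_pow_succ (hR : R * R = w • R + 1) (hx : Commute x g)
    (hY : Commute (R * x * R) g) (hYx : Commute (R * x * R) x) (i : ℕ) :
    R * x ^ (i + 1) * R * g - g * (R * x ^ (i + 1) * R) =
      -(w • ∑ a ∈ Finset.range i, x ^ (i - a) * (R * g - g * R) * x ^ (a + 1)) := by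
  have hL := mul_commutator hR hx hY
  induction i with
  | zero =>
    rw [pow_succ', pow_zero, commutator_mul_left hR hY (Commute.one_left g), commutator_one hR]
    simp [hL]
  | succ i ih =>
    rw [pow_succ', commutator_mul_left hR hY (hx.pow_left _), ih, mul_neg, mul_smul_comm,
      Finset.mul_sum, Finset.sum_range_succ', smul_add, neg_add, sub_eq_add_neg]
    congr 3
    · refine Finset.sum_congr rfl fun a _ => ?_
      rw [mul_assoc (x ^ (i - a)), ← mul_assoc (R * x * R), (hYx.pow_right _).eq, mul_assoc,
        ← mul_assoc (R * x * R), hL, Nat.add_sub_add_right, pow_succ' x (a + 1)]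
      simp only [mul_assoc]
    · rw [← mul_assoc, (hYx.pow_right _).eq, mul_assoc, hL, zero_add, pow_one, Nat.sub_zero,
        mul_assoc]

lemma commutator_inv (hR : R * R = w • R + 1) (hx : Commute x g) (hx' : Commute x' g)
    (hY : Commute (R * x * R) g) (hxx' : x * x' = 1)
    (hx'x : x' * x = 1) :
    R * x' * R * g - g * (R * x' * R) =
      w • (x' * (R * g - g * R) + (R * g - g * R) * x') := by
  have hL := mul_commutator hR hx hY
  have hRinv : (R - w • 1) * R = 1 := by rw [sub_mul, hR, smul_one_mul]; abel
  have hYinv : (R - w • 1) * x' * (R - w • 1) * (R * x * R) = 1 := by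
    calc _ = (R - w • 1) * (x' * (((R - w • 1) * R) * (x * R))) := by simp only [mul_assoc]
      _ = (R - w • 1) * (x' * x * R) := by rw [hRinv, one_mul, mul_assoc x']
      _ = 1 := by rw [hx'x, one_mul, hRinv]
  have h := commutator_mul_left hR hY hx'
  rw [hxx', commutator_one hR, eq_sub_iff_add_eq, ← smul_add] at h
  have h' : R * x * R * (R * x' * R * g - g * (R * x' * R)) =
      R * x * R * (w • (x' * (R * g - g * R) + (R * g - g * R) * x')) := by
    rw [← h, mul_smul_comm, mul_add, ← mul_assoc _ _ x', hL, mul_assoc _ x x', hxx', mul_one,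
      add_comm]
  have h'' := congrArg (fun t => (R - w • 1) * x' * (R - w • 1) * t) h'
  simpa only [← mul_assoc _ (R * x * R), hYinv, one_mul] using h''

end CommutatorIdentities

section ReflectionCoefficients

variable {W E Cc : Type} [Field W] [Ring E] [Algebra W E] [CommRing Cc] [Algebra W Cc]

/-- the element `f' κ' + ∑_{i ≤ m} f_i κ^i` -/
def smallElt {S : Type} [Ring S] [Algebra W S] (κ κ' : S) (f' : W) (f : ℕ → W) (m : ℕ) : S :=
  f' • κ' + ∑ i ∈ Finset.range (m + 1), f i • κ ^ i

lemma map_smallElt {S T : Type} [Ring S] [Algebra W S] [Ring T] [Algebra W T] (φ : S →ₐ[W] T)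
    (κ κ' : S) (f' : W) (f : ℕ → W) (m : ℕ) :
    φ (smallElt κ κ' f' f m) = smallElt (φ κ) (φ κ') f' f m := by
  simp [smallElt]

variable {R : E} {w : W} {j : Cc →ₐ[W] E} {κ κ' : Cc} {D : E →ₗ[W] W} {l l' : Cc →ₗ[W] W}

lemma apply_commutator (hD : ∀ a b, D (j a * R * j b) = l a * l' b) (g a b : Cc) :
    D (j a * (R * j g - j g * R) * j b) = l a * l' (g * b) - l (a * g) * l' b := by
  rw [← hD, ← hD, map_mul j, map_mul j, ← map_sub]
  congr 1
  noncomm_ring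

lemma apply_commutator_left (hD : ∀ a b, D (j a * R * j b) = l a * l' b) (g a : Cc) :
    D (j a * (R * j g - j g * R)) = l a * l' g - l (a * g) * l' 1 := by
  simpa using apply_commutator hD g a 1

lemma apply_commutator_right (hD : ∀ a b, D (j a * R * j b) = l a * l' b) (g b : Cc) :
    D ((R * j g - j g * R) * j b) = l 1 * l' (g * b) - l g * l' b := by
  simpa using apply_commutator hD g 1 b

lemma apply_commutator_smallElt (hR : R * R = w • R + 1)
    (hY : ∀ c, Commute (R * j κ * R) (j c)) (hκ : κ * κ' = 1)
    (hD : ∀ a b, D (j a * R * j b) = l a * l' b) (f' : W) (f : ℕ → W) (m : ℕ) (g : Cc) :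
    D (R * j (smallElt κ κ' f' f m) * R * j g - j g * (R * j (smallElt κ κ' f' f m) * R)) =
      w * (f' * (l κ' * l' g - l (κ' * g) * l' 1 + (l 1 * l' (g * κ') - l g * l' κ')) +
        f 0 * (l 1 * l' g - l g * l' 1) -
        ∑ i ∈ Finset.range m, f (i + 1) * ∑ a ∈ Finset.range i,
          (l (κ ^ (i - a)) * l' (g * κ ^ (a + 1)) -
            l (κ ^ (i - a) * g) * l' (κ ^ (a + 1)))) := by
  have hj : ∀ a b : Cc, Commute (j a) (j b) := fun a b => (Commute.all a b).map j
  let T : Cc →ₗ[W] W := D ∘ₗ (LinearMap.mulRight W (j g) - LinearMap.mulLeft W (j g)) ∘ₗ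
    LinearMap.mulRight W R ∘ₗ LinearMap.mulLeft W R ∘ₗ j.toLinearMap
  have hT : ∀ c, T c = D (R * j c * R * j g - j g * (R * j c * R)) := fun c => rfl
  have hT' : T κ' = w * (l κ' * l' g - l (κ' * g) * l' 1 + (l 1 * l' (g * κ') - l g * l' κ')) := by
    rw [hT, commutator_inv hR (hj κ g) (hj κ' g) (hY g) (by rw [← map_mul, hκ, map_one])
      (by rw [← map_mul, mul_comm, hκ, map_one]), map_smul, map_add, apply_commutator_left hD,
      apply_commutator_right hD, smul_eq_mul]
  have hT0 : T (κ ^ 0) = w * (l 1 * l' g - l g * l' 1) := by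
    rw [hT, pow_zero, map_one, commutator_one hR, map_smul, smul_eq_mul,
      ← mul_one (R * j g - j g * R), ← map_one j, apply_commutator_right hD, mul_one]
  have hTs : ∀ i, T (κ ^ (i + 1)) = -(w * ∑ a ∈ Finset.range i,
      (l (κ ^ (i - a)) * l' (g * κ ^ (a + 1)) - l (κ ^ (i - a) * g) * l' (κ ^ (a + 1)))) := by
    intro i
    rw [hT, map_pow, commutator_pow_succ hR (hj κ g) (hY g) (hY κ), map_neg, map_smul, map_sum,
      smul_eq_mul]
    simp only [← map_pow, apply_commutator hD]
  rw [← hT, smallElt, map_add, map_smul, map_sum, Finset.sum_range_succ', map_smul, hT0, hT']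
  simp only [map_smul, hTs, smul_eq_mul, mul_neg, Finset.sum_neg_distrib]
  simp only [mul_left_comm _ w, ← Finset.mul_sum]
  ring

/-- The scalar equation obtained by applying a functional to the reflection equation. -/
lemma apply_reflection {a b : W} {F g : Cc} (hD : ∀ a b, D (j a * R * j b) = l a * l' b)
    (h : ((1 - a) • R + (a * w) • 1) * j F * ((1 - b) • R + (b * w) • 1) * j g =
      j g * ((1 - b) • R + (b * w) • 1) * j F * ((1 - a) • R + (a * w) • 1)) :
    (1 - a) * (1 - b) * D (R * j F * R * j g - j g * (R * j F * R)) +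
      (1 - a) * (b * w) * (l 1 * l' (F * g) - l (F * g) * l' 1) +
      a * w * (1 - b) * (l F * l' g - l g * l' F) = 0 := by
  have h₁ : D (R * j F * j g) = l 1 * l' (F * g) := by
    rw [← hD, map_one, one_mul, map_mul j, ← mul_assoc]
  have h₂ : D (j g * j F * R) = l (F * g) * l' 1 := by
    rw [← hD, map_one, mul_one, map_mul j, ((Commute.all F g).map j).eq]
  rw [← h₁, ← h₂, ← hD, ← hD]
  have h' := congrArg D h
  simp only [add_mul, mul_add, smul_mul_assoc, mul_smul_comm, map_add, map_smul, smul_eq_mul,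
    one_mul, mul_one, ← mul_assoc] at h'
  rw [((Commute.all F g).map j).eq] at h'
  rw [map_sub, ← mul_assoc, ← mul_assoc]
  linear_combination h'

variable {L : ℕ → Cc →ₗ[W] W} {n : ℕ}

lemma apply_smallElt (hL : ∀ A < n, ∀ i < n, L A (κ ^ i) = if i = A then 1 else 0)
    (hL' : ∀ A < n, L A κ' = 0) (f' : W) (f : ℕ → W) {m A : ℕ} (hm : m < n) (hA : A < n) :
    L A (smallElt κ κ' f' f m) = if A ≤ m then f A else 0 := by
  rw [smallElt, map_add, map_smul, hL' A hA, smul_zero, zero_add, map_sum]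
  simp only [map_smul, smul_eq_mul]
  rw [Finset.sum_congr rfl (g := fun i => if i = A then f i else 0) fun i hi => by
    rw [hL A hA i (by have := Finset.mem_range.1 hi; omega), mul_ite, mul_one, mul_zero]]
  rw [Finset.sum_ite_eq']
  simp

lemma apply_smallElt_mul_pow (hκ : κ * κ' = 1)
    (hL : ∀ A < n, ∀ i < n, L A (κ ^ i) = if i = A then 1 else 0)
    (f' : W) (f : ℕ → W) {m A t : ℕ} (hA : A < n) (hmA : m + t + 1 ≤ A) :
    L A (smallElt κ κ' f' f m * κ ^ (t + 1)) = if A = m + t + 1 then f m else 0 := by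
  rw [smallElt, add_mul, smul_mul_assoc, pow_succ', ← mul_assoc, mul_comm κ', hκ, one_mul,
    map_add, map_smul, hL A hA t (by omega), if_neg (by omega), smul_zero, zero_add,
    Finset.sum_mul, map_sum, ← pow_succ']
  simp only [smul_mul_assoc, ← pow_add, map_smul, smul_eq_mul]
  rw [Finset.sum_range_succ, Finset.sum_eq_zero, zero_add, hL A hA _ (by omega)]
  · split_ifs <;> first | omega | simp
  · intro i hi
    have := Finset.mem_range.1 hi
    rw [hL A hA _ (by omega), if_neg (by omega), mul_zero]


lemma top_coeff_mul_eq_zero (hR : R * R = w • R + 1)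
    (hY : ∀ c, Commute (R * j κ * R) (j c)) (hκ : κ * κ' = 1)
    (hL : ∀ A < n, ∀ i < n, L A (κ ^ i) = if i = A then 1 else 0)
    (hL' : ∀ A < n, L A κ' = 0)
    (hD : ∀ l l' : Cc →ₗ[W] W, ∃ D : E →ₗ[W] W, ∀ a b, D (j a * R * j b) = l a * l' b)
    (hw : w ≠ 0) {a b : W} (ha : a ≠ 1) (hb : b ≠ 1) {f' g' : W} {f g : ℕ → W} {m : ℕ}
    (hm : 2 ≤ m) (hmn : m + 2 ≤ n)
    (h : ((1 - a) • R + (a * w) • 1) * j (smallElt κ κ' f' f m) *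
        ((1 - b) • R + (b * w) • 1) * j (smallElt κ κ' g' g m) =
      j (smallElt κ κ' g' g m) * ((1 - b) • R + (b * w) • 1) *
        j (smallElt κ κ' f' f m) * ((1 - a) • R + (a * w) • 1)) :
    f m * g m = 0 := by
  obtain ⟨A, B, hA, hAm, hmB, hBn, hAB⟩ : ∃ A B, 1 ≤ A ∧ A < m ∧ m < B ∧ B < n ∧ A + B = 2 * m := by
    rcases le_total (2 * m) n with h | h
    · exact ⟨1, 2 * m - 1, by omega⟩
    · exact ⟨2 * m - n + 1, n - 1, by omega⟩
  obtain ⟨D, hD⟩ := hD (L A) (L B)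
  have hred := apply_reflection hD h
  have h1 : ∀ C, 1 ≤ C → C < n → L C 1 = 0 := fun C hC hCn => by
    rw [← pow_zero κ, hL C hCn 0 (by omega), if_neg (by omega)]
  have hBsmall : ∀ f' f, L B (smallElt κ κ' f' f m) = 0 := fun f' f => by
    rw [apply_smallElt hL hL' _ _ (by omega) hBn, if_neg (by omega)]
  have hsum : ∑ i ∈ Finset.range m, f (i + 1) * ∑ a ∈ Finset.range i,
      (L A (κ ^ (i - a)) * L B (smallElt κ κ' g' g m * κ ^ (a + 1)) -
        L A (κ ^ (i - a) * smallElt κ κ' g' g m) * L B (κ ^ (a + 1))) = f m * g m := by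
    have hterm : ∀ i < m, ∀ a < i, L A (κ ^ (i - a)) * L B (smallElt κ κ' g' g m * κ ^ (a + 1)) -
        L A (κ ^ (i - a) * smallElt κ κ' g' g m) * L B (κ ^ (a + 1)) =
        if i = m - 1 ∧ a = m - 1 - A then g m else 0 := by
      intro i hi a ha
      rw [hL B hBn (a + 1) (by omega), if_neg (by omega), mul_zero, sub_zero,
        hL A (by omega) _ (by omega)]
      split_ifs with h₁ h₂ h₂
      · rw [apply_smallElt_mul_pow hκ hL _ _ hBn (by omega), if_pos (by omega), one_mul]
      · rw [apply_smallElt_mul_pow hκ hL _ _ hBn (by omega), if_neg (by omega), mul_zero]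
      · omega
      · rw [zero_mul]
    rw [Finset.sum_eq_single (m - 1), Finset.sum_eq_single (m - 1 - A),
      hterm _ (by omega) _ (by omega), if_pos ⟨rfl, rfl⟩, Nat.sub_add_cancel (by omega)]
    · intro a ha hne
      rw [hterm _ (by omega) _ (Finset.mem_range.1 ha), if_neg (by omega)]
    · intro hne
      simp at hne
      omega
    · intro i hi hne
      rw [Finset.sum_eq_zero, mul_zero]
      intro a ha
      rw [hterm _ (Finset.mem_range.1 hi) _ (Finset.mem_range.1 ha), if_neg (by omega)]
    · intro hne
      simp at hne
      omega
  rw [apply_commutator_smallElt hR hY hκ hD, hsum, hBsmall, hBsmall, hL' A (by omega), hL' B hBn,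
    h1 A hA (by omega), h1 B (by omega) hBn] at hred
  have : (1 - a) * (1 - b) * w * (f m * g m) = 0 := by linear_combination -hred
  simpa [sub_eq_zero, ha.symm, hb.symm, hw] using this

lemma coeff_eq_zero_of_linear (hR : R * R = w • R + 1)
    (hY : ∀ c, Commute (R * j κ * R) (j c)) (hκ : κ * κ' = 1)
    (hL : ∀ A < n, ∀ i < n, L A (κ ^ i) = if i = A then 1 else 0)
    (hL' : ∀ A < n, L A κ' = 0) (hη : L (n - 1) (κ' * κ') ≠ 0) (hn : 4 ≤ n)
    (hD : ∀ l l' : Cc →ₗ[W] W, ∃ D : E →ₗ[W] W, ∀ a b, D (j a * R * j b) = l a * l' b)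
    (hw : w ≠ 0) {a b : W} (ha : a ≠ 1) (hb : b ≠ 0) {f' g' : W} {f g : ℕ → W}
    (hfg' : f' = 0 ↔ g' = 0) (hfg : f 1 = 0 ↔ g 1 = 0)
    (h : ((1 - a) • R + (a * w) • 1) * j (smallElt κ κ' f' f 1) *
        ((1 - b) • R + (b * w) • 1) * j (smallElt κ κ' g' g 1) =
      j (smallElt κ κ' g' g 1) * ((1 - b) • R + (b * w) • 1) *
        j (smallElt κ κ' f' f 1) * ((1 - a) • R + (a * w) • 1)) :
    f' = 0 ∧ f 1 = 0 := by
  have hsmall : ∀ (f' : W) f, smallElt κ κ' f' f 1 = f' • κ' + f 0 • 1 + f 1 • κ := fun f' f => by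
    rw [smallElt, Finset.sum_range_succ, Finset.sum_range_one, pow_zero, pow_one, add_assoc]
  have h1 : ∀ C < n, L C 1 = if 0 = C then 1 else 0 := fun C hC => by
    rw [← pow_zero κ, hL C hC 0 (by omega)]
  have hLκ : ∀ C < n, L C κ = if 1 = C then 1 else 0 := fun C hC => by
    rw [← hL C hC 1 (by omega), pow_one]
  have hLκκ : ∀ C < n, L C (κ * κ) = if 2 = C then 1 else 0 := fun C hC => by
    rw [← hL C hC 2 (by omega), pow_two]
  have key : ∀ B, 2 ≤ B → B < n → (1 - a) * (w * f' * L B (smallElt κ κ' g' g 1 * κ')) * (1 - b) +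
      (1 - a) * (b * w) * L B (smallElt κ κ' f' f 1 * smallElt κ κ' g' g 1) = 0 := by
    intro B hB hBn
    obtain ⟨D, hD⟩ := hD (L 0) (L B)
    have hred := apply_reflection hD h
    have hBsmall : ∀ f' f, L B (smallElt κ κ' f' f 1) = 0 := fun f' f => by
      rw [apply_smallElt hL hL' _ _ (by omega) hBn, if_neg (by omega)]
    rw [apply_commutator_smallElt hR hY hκ hD, hBsmall, hBsmall, hL' 0 (by omega), hL' B hBn,
      h1 0 (by omega), h1 B hBn, if_pos rfl, if_neg (by omega)] at hred
    simp only [Finset.sum_range_one, Finset.range_zero, Finset.sum_empty] at hred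
    linear_combination hred
  have hmulκ' : ∀ (g' : W) g, smallElt κ κ' g' g 1 * κ' = g' • (κ' * κ') + g 0 • κ' + g 1 • 1 :=
    fun g' g => by
      rw [hsmall, add_mul, add_mul, smul_mul_assoc, smul_mul_assoc, smul_mul_assoc, one_mul, hκ]
  have hmul : smallElt κ κ' f' f 1 * smallElt κ κ' g' g 1 = (f' * g') • (κ' * κ') +
      (f' * g 0 + f 0 * g') • κ' + (f 0 * g 0 + f' * g 1 + f 1 * g') • 1 +
      (f 0 * g 1 + f 1 * g 0) • κ + (f 1 * g 1) • (κ * κ) := by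
    rw [hsmall, hsmall]
    simp only [Algebra.smul_def, map_mul, map_add]
    linear_combination (algebraMap W Cc f' * algebraMap W Cc (g 1) +
      algebraMap W Cc (f 1) * algebraMap W Cc g') * hκ
  have hf' : f' = 0 := by
    have := key (n - 1) (by omega) (by omega)
    rw [hmulκ', hmul] at this
    simp only [map_add, map_smul, smul_eq_mul, hL' (n - 1) (by omega), h1 (n - 1) (by omega),
      hLκ (n - 1) (by omega), hLκκ (n - 1) (by omega)] at this
    rw [if_neg (by omega), if_neg (by omega), if_neg (by omega)] at this
    have : (1 - a) * w * (f' * g') * L (n - 1) (κ' * κ') = 0 := by linear_combination this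
    simpa [sub_eq_zero, ha.symm, hw, hη, ← hfg'] using this
  have hg' := hfg'.1 hf'
  refine ⟨hf', ?_⟩
  have := key 2 le_rfl (by omega)
  rw [hmul, hf', hg'] at this
  simp only [map_add, map_smul, smul_eq_mul, hL' 2 (by omega), h1 2 (by omega),
    hLκ 2 (by omega), hLκκ 2 (by omega)] at this
  have : (1 - a) * (b * w) * (f 1 * g 1) = 0 := by simpa using this
  simpa [sub_eq_zero, ha.symm, hb, hw, ← hfg] using this

/-- For `n ≥ 4`, a small solution has no non-constant part. -/
theorem small_coeff_eq_zero (hR : R * R = w • R + 1)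
    (hY : ∀ c, Commute (R * j κ * R) (j c)) (hκ : κ * κ' = 1)
    (hL : ∀ A < n, ∀ i < n, L A (κ ^ i) = if i = A then 1 else 0)
    (hL' : ∀ A < n, L A κ' = 0) (hη : L (n - 1) (κ' * κ') ≠ 0) (hn : 4 ≤ n)
    (hD : ∀ l l' : Cc →ₗ[W] W, ∃ D : E →ₗ[W] W, ∀ a b, D (j a * R * j b) = l a * l' b)
    (hw : w ≠ 0) {a b : W} (ha : a ≠ 1) (hb : b ≠ 0) (hb' : b ≠ 1) {f' g' : W} {f g : ℕ → W}
    (hfg' : f' = 0 ↔ g' = 0) (hfg : ∀ i, f i = 0 ↔ g i = 0) (m : ℕ) (hm : 1 ≤ m)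
    (hmn : m + 2 ≤ n)
    (h : ((1 - a) • R + (a * w) • 1) * j (smallElt κ κ' f' f m) *
        ((1 - b) • R + (b * w) • 1) * j (smallElt κ κ' g' g m) =
      j (smallElt κ κ' g' g m) * ((1 - b) • R + (b * w) • 1) *
        j (smallElt κ κ' f' f m) * ((1 - a) • R + (a * w) • 1)) :
    f' = 0 ∧ ∀ i, 1 ≤ i → i ≤ m → f i = 0 := by
  induction m, hm using Nat.le_induction with
  | base =>
    have := coeff_eq_zero_of_linear hR hY hκ hL hL' hη hn hD hw ha hb hfg' (hfg 1) h
    exact ⟨this.1, fun i h₁ h₂ => le_antisymm h₂ h₁ ▸ this.2⟩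
  | succ m hm ih =>
    have hf : f (m + 1) = 0 := by
      have := top_coeff_mul_eq_zero hR hY hκ hL hL' hD hw ha hb' (by omega) hmn h
      simpa [← hfg] using this
    have hsucc : ∀ (f' : W) {f : ℕ → W}, f (m + 1) = 0 →
        smallElt κ κ' f' f (m + 1) = smallElt κ κ' f' f m := fun f' f hf => by
      rw [smallElt, Finset.sum_range_succ, hf, zero_smul, add_zero, smallElt]
    rw [hsucc f' hf, hsucc g' ((hfg _).1 hf)] at h
    obtain ⟨h₁, h₂⟩ := ih (by omega) h
    refine ⟨h₁, fun i hi hi' => ?_⟩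
    rcases hi'.lt_or_eq with h | rfl
    · exact h₂ i hi (by omega)
    · exact hf

end ReflectionCoefficients

section CyclotomicQuotient
open Polynomial

variable {W : Type}

lemma natDegree_sum_C_mul_X_pow_le [CommRing W] (n : ℕ) (A : ℕ → W) :
    (∑ i ∈ Finset.range (n + 1), C (A i) * X ^ (n - i)).natDegree ≤ n :=
  natDegree_sum_le_of_forall_le _ _ fun i _ =>
    (natDegree_C_mul_X_pow_le _ _).trans (Nat.sub_le n i)

lemma qPoly_monic [CommRing W] (n : ℕ) (A : ℕ → W) : (qPoly W n A).Monic :=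
  monic_X_pow_sub ((natDegree_le_iff_degree_le.1 (natDegree_sum_C_mul_X_pow_le n A)).trans_lt
    (by exact_mod_cast n.lt_succ_self))

lemma natDegree_qPoly [CommRing W] [Nontrivial W] (n : ℕ) (A : ℕ → W) :
    (qPoly W n A).natDegree = n + 1 := by
  rw [qPoly, natDegree_sub_eq_left_of_natDegree_lt, natDegree_X_pow]
  rw [natDegree_X_pow, Nat.lt_succ_iff]
  exact natDegree_sum_C_mul_X_pow_le n A

variable [Field W]

/-- the inverse of the variable in the quotient of `W[u]` by `qPoly` -/
def rootInv (n : ℕ) (A : ℕ → W) (η : W) : W[X] :=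
  C η * (X ^ n - ∑ i ∈ Finset.range n, C (A i) * X ^ (n - 1 - i))

lemma X_mul_rootInv {n : ℕ} {A : ℕ → W} {η : W} (hη : A n * η = 1) :
    X * rootInv n A η = 1 + C η * qPoly W n A := by
  have h : (∑ i ∈ Finset.range n, C (A i) * X ^ (n - i)) =
      X * ∑ i ∈ Finset.range n, C (A i) * X ^ (n - 1 - i) := by
    rw [Finset.mul_sum]
    refine Finset.sum_congr rfl fun i hi => ?_
    have := Finset.mem_range.1 hi
    rw [show n - i = n - 1 - i + 1 by omega, pow_succ']
    ring
  rw [qPoly, rootInv, Finset.sum_range_succ, h, Nat.sub_self, pow_zero, mul_one]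
  have : C (A n) * C η = (1 : W[X]) := by rw [← C_mul, hη, C_1]
  linear_combination this

lemma modByMonicHom_mk_of_natDegree_le {P : W[X]} (hP : P.Monic) {f : W[X]}
    (hf : f.natDegree < P.natDegree) :
    AdjoinRoot.modByMonicHom hP (AdjoinRoot.mk P f) = f := by
  rw [AdjoinRoot.modByMonicHom_mk, modByMonic_eq_self_iff hP]
  exact degree_lt_degree hf

/-- A representation of the cyclotomic Hecke algebra over a field in which, when `n ≥ 4`,
the coefficients of small solutions of the reflection equation vanish. -/
theorem exists_representation_small_coeff_eq_zero {q : W} (hq : q ≠ 0) (hw : q - q⁻¹ ≠ 0) {n : ℕ}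
    (hn : 4 ≤ n) {A : ℕ → W} {η : W} (hη : A n * η = 1) :
    ∃ (E : Type) (_ : Ring E) (_ : Algebra W E) (R K K' : E),
      R * R = (q - q⁻¹) • R + 1 ∧ R * K * R * K = K * R * K * R ∧
      -K ^ (n + 1) + ∑ i ∈ Finset.range (n + 1), A i • K ^ (n - i) = 0 ∧
      K' = η • (K ^ n - ∑ i ∈ Finset.range n, A i • K ^ (n - 1 - i)) ∧
      ∀ (a b f' g' : W) (f g : ℕ → W), a ≠ 1 → b ≠ 0 → b ≠ 1 → (f' = 0 ↔ g' = 0) →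
        (∀ i, f i = 0 ↔ g i = 0) →
        ((1 - a) • R + (a * (q - q⁻¹)) • 1) * smallElt K K' f' f (n - 2) *
            ((1 - b) • R + (b * (q - q⁻¹)) • 1) * smallElt K K' g' g (n - 2) =
          smallElt K K' g' g (n - 2) * ((1 - b) • R + (b * (q - q⁻¹)) • 1) *
            smallElt K K' f' f (n - 2) * ((1 - a) • R + (a * (q - q⁻¹)) • 1) →
        f' = 0 ∧ ∀ i, 1 ≤ i → i ≤ n - 2 → f i = 0 := by
  obtain ⟨P, hPdef⟩ : ∃ P, P = qPoly W n A := ⟨_, rfl⟩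
  have hP : P.Monic := hPdef ▸ qPoly_monic n A
  have hPn : P.natDegree = n + 1 := hPdef ▸ natDegree_qPoly n A
  obtain ⟨E, hE, hEA, R, j, hR, hY, hD⟩ := exists_cyclotomic_representation hq hP hPn
  obtain ⟨κ, hκX⟩ : ∃ κ, κ = AdjoinRoot.mk P X := ⟨_, rfl⟩
  obtain ⟨κ', hκ'⟩ : ∃ κ', κ' = AdjoinRoot.mk P (rootInv n A η) := ⟨_, rfl⟩
  rw [← AdjoinRoot.mk_X, ← hκX] at hY
  have hκ : κ * κ' = 1 := by
    rw [hκX, hκ', ← map_mul, X_mul_rootInv hη, ← hPdef, map_add, map_mul, AdjoinRoot.mk_self,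
      mul_zero, add_zero, map_one]
  let L : ℕ → AdjoinRoot P →ₗ[W] W := fun A' =>
    lcoeff W (A' + 1) ∘ₗ AdjoinRoot.modByMonicHom hP ∘ₗ LinearMap.mulLeft W κ
  have hLmk : ∀ A' c (f : W[X]), f.natDegree ≤ n → κ * c = AdjoinRoot.mk P f →
      L A' c = f.coeff (A' + 1) := by
    intro A' c f hf hc
    change (AdjoinRoot.modByMonicHom hP (κ * c)).coeff (A' + 1) = _
    rw [hc, modByMonicHom_mk_of_natDegree_le hP (by omega)]
  have hdeg : (∑ i ∈ Finset.range n, C (A i) * X ^ (n - 1 - i)).natDegree < n := by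
    refine lt_of_le_of_lt (natDegree_sum_le_of_forall_le (n := n - 1) _ _ fun i _ =>
      (natDegree_C_mul_X_pow_le _ _).trans (Nat.sub_le _ i)) (by omega)
  have hL : ∀ A' < n, ∀ i < n, L A' (κ ^ i) = if i = A' then 1 else 0 := fun A' hA' i hi => by
    rw [hLmk A' _ (X ^ (i + 1)) (by rw [natDegree_X_pow]; omega)
      (by rw [← pow_succ', map_pow, hκX]), coeff_X_pow]
    simp only [Nat.add_right_cancel_iff, eq_comm]
  have hL' : ∀ A' < n, L A' κ' = 0 := fun A' hA' => by
    rw [hLmk A' _ 1 (by simp) (by rw [hκ, map_one]), coeff_one, if_neg (by omega)]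
  have hη' : L (n - 1) (κ' * κ') ≠ 0 := by
    rw [hLmk _ _ (rootInv n A η) ((natDegree_C_mul_le _ _).trans ((natDegree_sub_le _ _).trans
      (max_le (natDegree_X_pow_le n) hdeg.le))) (by rw [← mul_assoc, hκ, one_mul, hκ']),
      Nat.sub_add_cancel (by omega), rootInv, coeff_C_mul, coeff_sub, coeff_X_pow_self,
      coeff_eq_zero_of_natDegree_lt hdeg, sub_zero, mul_one]
    exact right_ne_zero_of_mul_eq_one hη
  have hof : ∀ c : W, j (AdjoinRoot.of P c) = algebraMap W E c := fun c => j.commutes c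
  refine ⟨E, hE, hEA, R, j κ, j κ', hR, ?_, ?_, ?_, ?_⟩
  · rw [← (hY κ).eq, mul_assoc, mul_assoc, mul_assoc]
  · have h : j (AdjoinRoot.mk P (qPoly W n A)) = 0 := by
      rw [← hPdef, AdjoinRoot.mk_self, map_zero]
    rw [← neg_eq_zero, neg_add, neg_neg, ← sub_eq_add_neg]
    simpa [qPoly, hκX, hof, Algebra.smul_def] using h
  · simp [rootInv, hκX, hκ', hof, Algebra.smul_def]
  · intro a b f' g' f g ha hb hb' hfg' hfg h
    rw [← map_smallElt, ← map_smallElt] at h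
    exact small_coeff_eq_zero hR (fun c => (hY c).symm) hκ hL hL' hη' hn hD hw ha hb hb' hfg' hfg
      (n - 2) (by omega) (by omega) h

end CyclotomicQuotient

section ScalarElements

/-- the map `𝔷(x) → B(x)` induced by the structure map `𝔷 → B` -/
def scalarHom [IsScalarTower k z B] : RatFunc k ⊗[k] z →ₐ[RatFunc k] RatFunc k ⊗[k] B :=
  Algebra.TensorProduct.map (AlgHom.id (RatFunc k) (RatFunc k)) (IsScalarTower.toAlgHom k z B)

variable {k z}

lemma scalarHom_tmul [IsScalarTower k z B] (r : RatFunc k) (a : z) :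
    scalarHom k z (B := B) (r ⊗ₜ a) = r ⊗ₜ algebraMap z B a := rfl

lemma one_tmul_smul [IsScalarTower k z B] (a : z) (x : B) :
    (1 : RatFunc k) ⊗ₜ[k] (a • x) =
      scalarHom k z (B := B) (1 ⊗ₜ a) * ((1 : RatFunc k) ⊗ₜ[k] x) := by
  rw [scalarHom_tmul, Algebra.TensorProduct.tmul_mul_tmul, one_mul, Algebra.smul_def]

lemma one_tmul_smul_pow [IsScalarTower k z B] (a : z) (x : B) (i : ℕ) :
    (1 : RatFunc k) ⊗ₜ[k] (a • x ^ i) =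
      scalarHom k z (B := B) (1 ⊗ₜ a) * ((1 : RatFunc k) ⊗ₜ[k] x) ^ i := by
  rw [one_tmul_smul, Algebra.TensorProduct.tmul_pow, one_pow]

lemma isScalarElt_scalarHom [IsScalarTower k z B] (s : RatFunc k ⊗[k] z) :
    IsScalarElt k z (scalarHom k z (B := B) s) := by
  induction s with
  | zero => rw [map_zero]; exact zero_mem _
  | add s t hs ht => rw [map_add]; exact add_mem hs ht
  | tmul r a =>
    have h : scalarHom k z (B := B) (r ⊗ₜ a) = r • ((1 : RatFunc k) ⊗ₜ algebraMap z B a) := by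
      rw [scalarHom_tmul, TensorProduct.smul_tmul', smul_eq_mul, mul_one]
    rw [h]
    exact Submodule.smul_mem _ _ (Submodule.subset_span ⟨a, rfl⟩)

end ScalarElements

section Expansion

variable {k z ω} {n : ℕ} {A : ℕ → z}

lemma aeval_Kp_qPoly : Polynomial.aeval (Kp z ω n A) (qPoly z n A) = 0 := by
  have h : RingQuot.mkAlgHom z (CRel z ω n A) (pKelt z ω n A) = 0 := by
    rw [RingQuot.mkAlgHom_rel z (CRel.mk (z := z) (ω := ω)), map_zero]
  have h' : -(Kp z ω n A) ^ (n + 1) +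
      ∑ i ∈ Finset.range (n + 1), A i • Kp z ω n A ^ (n - i) = 0 := by
    refine Eq.trans ?_ h
    simp only [pKelt, map_add, map_neg, map_pow, map_sum, map_smul]
    rfl
  rw [← neg_eq_zero, ← h', qPoly]
  simp only [map_sub, map_pow, map_sum, map_mul, Polynomial.aeval_X,
    Polynomial.aeval_C, Algebra.smul_def]
  abel

lemma Kp_pow_eq [Nontrivial z] (m : ℕ) : ∃ b : ℕ → z,
    Kp z ω n A ^ m = ∑ i ∈ Finset.range (n + 1), b i • Kp z ω n A ^ i := by
  let r := (Polynomial.X ^ m : Polynomial z) %ₘ qPoly z n A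
  have hr : r.natDegree < n + 1 := by
    rw [← natDegree_qPoly n A]
    exact Polynomial.natDegree_modByMonic_lt _ (qPoly_monic n A) fun h => by
      simpa [h] using natDegree_qPoly n A
  refine ⟨r.coeff, ?_⟩
  rw [← Polynomial.aeval_eq_sum_range' hr]
  have h := congrArg (Polynomial.aeval (Kp z ω n A))
    (Polynomial.modByMonic_add_div (Polynomial.X ^ m : Polynomial z) (qPoly z n A))
  rw [map_add, map_mul, aeval_Kp_qPoly, zero_mul, add_zero, map_pow, Polynomial.aeval_X] at h
  exact h.symm

lemma exists_expansion_of_mem_KpX [Nontrivial z] {c : RatFunc k ⊗[k] Hp z ω n A}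
    (hc : c ∈ KpX k z ω n A) :
    ∃ F : ℕ → RatFunc k ⊗[k] z, c = ∑ i ∈ Finset.range (n + 1),
      scalarHom k z (F i) * ((1 : RatFunc k) ⊗ₜ[k] Kp z ω n A ^ i) := by
  rw [KpX, ← Subalgebra.mem_toSubmodule, Algebra.adjoin_eq_span] at hc
  induction hc using Submodule.span_induction with
  | zero => exact ⟨0, by simp⟩
  | add c d _ _ hc hd =>
    obtain ⟨F, rfl⟩ := hc
    obtain ⟨G, rfl⟩ := hd
    exact ⟨F + G, by simp only [Pi.add_apply, map_add, add_mul, Finset.sum_add_distrib]⟩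
  | smul r c _ hc =>
    obtain ⟨F, rfl⟩ := hc
    exact ⟨r • F, by simp only [Pi.smul_apply, map_smul, smul_mul_assoc, Finset.smul_sum]⟩
  | mem c hc =>
    have h : ∃ (a : z) (m : ℕ), c = (1 : RatFunc k) ⊗ₜ[k] (a • Kp z ω n A ^ m) := by
      induction hc using Submonoid.closure_induction with
      | one => exact ⟨1, 0, by rw [one_smul, pow_zero]; rfl⟩
      | mul c d _ _ hc hd =>
        obtain ⟨a, m, rfl⟩ := hc
        obtain ⟨b, l, rfl⟩ := hd
        exact ⟨a * b, m + l, by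
          rw [Algebra.TensorProduct.tmul_mul_tmul, one_mul, smul_mul_smul_comm, pow_add]⟩
      | mem c hc =>
        rcases hc with hc | ⟨a, rfl⟩
        · exact ⟨1, 1, by rw [one_smul, pow_one]; exact hc⟩
        · exact ⟨a, 0, by simp only [pow_zero, Algebra.algebraMap_eq_smul_one]⟩
    obtain ⟨a, m, rfl⟩ := h
    obtain ⟨b, hb⟩ := Kp_pow_eq (ω := ω) (n := n) (A := A) m
    refine ⟨fun i => 1 ⊗ₜ (a * b i), ?_⟩
    rw [hb, Finset.smul_sum, TensorProduct.tmul_sum]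
    refine Finset.sum_congr rfl fun i _ => ?_
    rw [smul_smul]
    exact one_tmul_smul_pow _ _ _

lemma one_tmul_Ktil {eta : z} (heta : A n * eta = 1) :
    (1 : RatFunc k) ⊗ₜ[k] Ktil z ω n A =
      scalarHom k z (1 ⊗ₜ A n) * ((1 : RatFunc k) ⊗ₜ[k] KinvN z ω n A eta) := by
  rw [scalarHom_tmul, Algebra.TensorProduct.tmul_mul_tmul, one_mul, KinvN, ← mul_assoc,
    ← map_mul, heta, map_one, one_mul, Ktil]
  simp only [Algebra.smul_def]

/-- Small elements of `𝒦_p(x)` are combinations of `1, K, …, K^(n-2)` and `K⁻¹`. -/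
lemma exists_small_expansion [Nontrivial z] (hn : 2 ≤ n) {eta : z} (heta : A n * eta = 1)
    {c : RatFunc k ⊗[k] Hp z ω n A} (hc : c ∈ KpX k z ω n A) (hp : ¬ IsPrincipal k z ω n A c) :
    ∃ (f : ℕ → RatFunc k ⊗[k] z) (f' : RatFunc k ⊗[k] z),
      c = (∑ i ∈ Finset.range (n - 1),
        scalarHom k z (f i) * ((1 : RatFunc k) ⊗ₜ[k] Kp z ω n A ^ i)) +
          scalarHom k z f' * ((1 : RatFunc k) ⊗ₜ[k] KinvN z ω n A eta) := by
  obtain ⟨F, hF⟩ := exists_expansion_of_mem_KpX hc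
  let f : ℕ → RatFunc k ⊗[k] z := fun i =>
    if i = n then F n else F i + F n * (1 ⊗ₜ A (n - 1 - i))
  have hfn : f n = F n := if_pos rfl
  have hsum : (1 : RatFunc k) ⊗ₜ[k] Ktil z ω n A = (1 : RatFunc k) ⊗ₜ[k] Kp z ω n A ^ n -
      ∑ i ∈ Finset.range n, scalarHom k z (1 ⊗ₜ A (n - 1 - i)) *
        ((1 : RatFunc k) ⊗ₜ[k] Kp z ω n A ^ i) := by
    rw [Ktil, TensorProduct.tmul_sub, TensorProduct.tmul_sum,
      show (1 : RatFunc k) ⊗ₜ[k] (Kp z ω n A ^ n) = ((1 : RatFunc k) ⊗ₜ[k] Kp z ω n A) ^ n by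
        rw [Algebra.TensorProduct.tmul_pow, one_pow],
      ← Finset.sum_range_reflect
        (fun i => scalarHom k z (1 ⊗ₜ A (n - 1 - i)) * ((1 : RatFunc k) ⊗ₜ[k] Kp z ω n A ^ i)) n]
    refine congrArg (fun t => (1 : RatFunc k) ⊗ₜ[k] Kp z ω n A ^ n - t)
      (Finset.sum_congr rfl fun i hi => ?_)
    have := Finset.mem_range.1 hi
    rw [one_tmul_smul_pow, show n - 1 - (n - 1 - i) = i by omega]
  have hcf : c = (∑ i ∈ Finset.range n,
      scalarHom k z (f i) * ((1 : RatFunc k) ⊗ₜ[k] Kp z ω n A ^ i)) +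
        scalarHom k z (f n) * ((1 : RatFunc k) ⊗ₜ[k] Ktil z ω n A) := by
    have hf : ∑ i ∈ Finset.range n,
        scalarHom k z (f i) * ((1 : RatFunc k) ⊗ₜ[k] Kp z ω n A ^ i) =
        ∑ i ∈ Finset.range n, scalarHom k z (F i) * ((1 : RatFunc k) ⊗ₜ[k] Kp z ω n A ^ i) +
        ∑ i ∈ Finset.range n, scalarHom k z (F n) * (scalarHom k z (1 ⊗ₜ A (n - 1 - i)) *
          ((1 : RatFunc k) ⊗ₜ[k] Kp z ω n A ^ i)) := by
      rw [← Finset.sum_add_distrib]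
      refine Finset.sum_congr rfl fun i hi => ?_
      simp only [f]
      rw [if_neg (Finset.mem_range.1 hi).ne, map_add, map_mul, add_mul, mul_assoc]
    rw [hf, hsum, mul_sub, Finset.mul_sum, hfn, hF, Finset.sum_range_succ]
    abel
  have hzero : scalarHom k z (B := Hp z ω n A) (f (n - 1)) = 0 := by
    by_contra hne
    exact hp (Or.inr ⟨by omega, fun i => scalarHom k z (f i),
      fun i => isScalarElt_scalarHom _, hcf, hne⟩)
  refine ⟨f, f n * (1 ⊗ₜ A n), ?_⟩
  obtain ⟨m, rfl⟩ : ∃ m, n = m + 1 := ⟨n - 1, by omega⟩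
  rw [Finset.sum_range_succ, Nat.add_sub_cancel] at *
  rw [map_mul, mul_assoc, ← one_tmul_Ktil heta, hcf, hzero, zero_mul, add_zero]

end Expansion

section Specialization

variable {z ω}

lemma exists_algHom_Hp {n : ℕ} {A : ℕ → z} {R K : B} (hR : R * R = ω • R + 1)
    (hRK : R * K * R * K = K * R * K * R)
    (hK : -K ^ (n + 1) + ∑ i ∈ Finset.range (n + 1), A i • K ^ (n - i) = 0) :
    ∃ ρ : Hp z ω n A →ₐ[z] B, ρ (Rp z ω n A) = R ∧ ρ (Kp z ω n A) = K := by
  let g : G → B := fun t => G.rec R K t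
  have h₀ : ∀ ⦃x y⦄, HRel z ω x y → FreeAlgebra.lift z g x = FreeAlgebra.lift z g y := by
    rintro _ _ (_ | _)
    · simpa [g] using hR
    · simpa [g] using hRK
  let ρ₀ : H z ω →ₐ[z] B := RingQuot.liftAlgHom z ⟨FreeAlgebra.lift z g, h₀⟩
  have hR₀ : ρ₀ (Rg z ω) = R :=
    (RingQuot.liftAlgHom_mkAlgHom_apply z _ h₀ _).trans (FreeAlgebra.lift_ι_apply _ _)
  have hK₀ : ρ₀ (Kg z ω) = K :=
    (RingQuot.liftAlgHom_mkAlgHom_apply z _ h₀ _).trans (FreeAlgebra.lift_ι_apply _ _)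
  have h₁ : ∀ ⦃x y⦄, CRel z ω n A x y → ρ₀ x = ρ₀ y := by
    rintro _ _ ⟨⟩
    rw [pKelt, map_zero, ← hK]
    simp only [map_add, map_neg, map_pow, map_sum, map_smul, hK₀]
  exact ⟨RingQuot.liftAlgHom z ⟨ρ₀, h₁⟩,
    (RingQuot.liftAlgHom_mkAlgHom_apply z _ h₁ _).trans hR₀,
    (RingQuot.liftAlgHom_mkAlgHom_apply z _ h₁ _).trans hK₀⟩

variable (z)

/-- the map `k[x,y] → Frac 𝔷[x,y]` -/
def polyFracMap : P2 k →ₐ[k] FractionRing (ZP2 z) :=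
  (IsScalarTower.toAlgHom k (ZP2 z) (FractionRing (ZP2 z))).comp
    (MvPolynomial.mapAlgHom (Algebra.ofId k z))

lemma polyFracMap_injective [IsDomain z] : Function.Injective (polyFracMap k z) :=
  (IsFractionRing.injective (ZP2 z) (FractionRing (ZP2 z))).comp
    (MvPolynomial.map_injective _ (algebraMap k z).injective)

/-- the map `k(x,y) → Frac 𝔷[x,y]` -/
def fracMap [IsDomain z] : F2 k →ₐ[k] FractionRing (ZP2 z) :=
  IsFractionRing.liftAlgHom (polyFracMap_injective k z)

lemma fracMap_algebraMap_X [IsDomain z] (e : Fin 2) :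
    fracMap k z (algebraMap (P2 k) (F2 k) (MvPolynomial.X e)) =
      algebraMap (ZP2 z) (FractionRing (ZP2 z)) (MvPolynomial.X e) := by
  rw [fracMap, IsFractionRing.liftAlgHom_apply, IsFractionRing.lift_algebraMap]
  simp [polyFracMap]

/-- the map `𝔷(x) → Frac 𝔷[x,y]` substituting the `e`-th variable -/
def scalarEval [IsDomain z] (e : Fin 2) : RatFunc k ⊗[k] z →ₐ[k] FractionRing (ZP2 z) :=
  Algebra.TensorProduct.lift ((fracMap k z).comp (emb k e))
    (IsScalarTower.toAlgHom k z (FractionRing (ZP2 z))) fun _ _ => Commute.all _ _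

lemma scalarEval_tmul [IsDomain z] (e : Fin 2) (r : RatFunc k) (a : z) :
    scalarEval k z e (r ⊗ₜ a) =
      fracMap k z (emb k e r) * algebraMap z (FractionRing (ZP2 z)) a := rfl

variable {k z}

/-- the inclusion of `𝔷[x]` into `𝔷(x)` -/
def polyIncl : Polynomial z →+* RatFunc k ⊗[k] z :=
  Polynomial.eval₂RingHom (Algebra.TensorProduct.includeRight (R := k) (A := RatFunc k)
    (B := z)).toRingHom (RatFunc.X ⊗ₜ 1)

lemma emb_X (e : Fin 2) :
    emb k e RatFunc.X = algebraMap (P2 k) (F2 k) (MvPolynomial.X e) := by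
  refine (RatFunc.liftRingHom_X (embP k e).toRingHom _).trans ?_
  simp [embP]

lemma scalarEval_polyIncl [IsDomain z] (e : Fin 2) (P : Polynomial z) :
    scalarEval k z e (polyIncl P) = algebraMap (ZP2 z) (FractionRing (ZP2 z)) (evP z e P) := by
  have h : ((scalarEval k z e).toRingHom.comp polyIncl) =
      (algebraMap (ZP2 z) (FractionRing (ZP2 z))).comp (evP z e).toRingHom := by
    ext a
    · simp [polyIncl, scalarEval_tmul, evP,
        IsScalarTower.algebraMap_apply z (ZP2 z) (FractionRing (ZP2 z))]
    · simp [polyIncl, scalarEval_tmul, evP, emb_X, fracMap_algebraMap_X]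
  exact congrArg (fun f : Polynomial z →+* FractionRing (ZP2 z) => f P) h

lemma algebraMap_tmul_one (d : Polynomial k) :
    algebraMap (Polynomial k) (RatFunc k) d ⊗ₜ[k] (1 : z) =
      polyIncl (d.map (algebraMap k z)) := by
  have h : ((Algebra.TensorProduct.includeLeft (R := k) (S := k) (A := RatFunc k)
      (B := z)).toRingHom.comp (algebraMap (Polynomial k) (RatFunc k))) =
      polyIncl.comp (Polynomial.mapRingHom (algebraMap k z)) := by
    ext a
    · simp [polyIncl, RatFunc.algebraMap_C]
    · simp [polyIncl]
  exact congrArg (fun f : Polynomial k →+* RatFunc k ⊗[k] z => f d) h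

lemma exists_denom (t : RatFunc k ⊗[k] z) : ∃ (d : Polynomial k) (P : Polynomial z), d ≠ 0 ∧
    algebraMap (Polynomial k) (RatFunc k) d ⊗ₜ[k] (1 : z) * t = polyIncl P := by
  induction t with
  | zero => exact ⟨1, 0, one_ne_zero, by rw [mul_zero, map_zero]⟩
  | add s t hs ht =>
    obtain ⟨d, P, hd, hs⟩ := hs
    obtain ⟨e, Q, he, ht⟩ := ht
    refine ⟨d * e, e.map (algebraMap k z) * P + d.map (algebraMap k z) * Q, mul_ne_zero hd he, ?_⟩
    rw [algebraMap_tmul_one] at hs ht ⊢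
    rw [map_add, map_mul polyIncl, map_mul polyIncl, ← hs, ← ht, Polynomial.map_mul, map_mul]
    ring
  | tmul r a =>
    refine ⟨r.denom, r.num.map (algebraMap k z) * Polynomial.C a, r.denom_ne_zero, ?_⟩
    rw [map_mul, ← algebraMap_tmul_one, Algebra.TensorProduct.tmul_mul_tmul, one_mul]
    have hr : algebraMap (Polynomial k) (RatFunc k) r.denom * r =
        algebraMap (Polynomial k) (RatFunc k) r.num := by
      conv_lhs => enter [2]; rw [← RatFunc.num_div_denom r]
      exact mul_div_cancel₀ _ (by simpa using r.denom_ne_zero)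
    rw [hr]
    simp [polyIncl]

lemma evP_injective (e : Fin 2) : Function.Injective (evP z e) :=
  transcendental_iff_injective.1 (MvPolynomial.transcendental_X z e)

lemma scalarEval_eq_zero_iff [IsDomain z] {e : Fin 2} {t : RatFunc k ⊗[k] z} :
    scalarEval k z e t = 0 ↔ t = 0 := by
  refine ⟨fun h => ?_, fun h => by rw [h, map_zero]⟩
  obtain ⟨d, P, hd, ht⟩ := exists_denom t
  have hP : P = 0 := by
    have h₁ := scalarEval_polyIncl e P (k := k)
    rw [← ht, map_mul, h, mul_zero, eq_comm,
      map_eq_zero_iff _ (IsFractionRing.injective (ZP2 z) (FractionRing (ZP2 z))),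
      map_eq_zero_iff _ (evP_injective e)] at h₁
    exact h₁
  have hd' : (algebraMap (Polynomial k) (RatFunc k) d) ≠ 0 := by
    simpa using hd
  calc t = ((algebraMap (Polynomial k) (RatFunc k) d)⁻¹ ⊗ₜ[k] (1 : z)) *
        (algebraMap (Polynomial k) (RatFunc k) d ⊗ₜ[k] (1 : z) * t) := by
        rw [← mul_assoc, Algebra.TensorProduct.tmul_mul_tmul, inv_mul_cancel₀ hd', one_mul,
          ← Algebra.TensorProduct.one_def, one_mul]
    _ = 0 := by rw [ht, hP, map_zero, mul_zero]

end Specialization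

section SpecializationHom

variable {z} [IsDomain z] [IsScalarTower k z B]
variable {E : Type} [Ring E] [Algebra (FractionRing (ZP2 z)) E] [Algebra z E] [Algebra k E]
  [IsScalarTower k (FractionRing (ZP2 z)) E] [IsScalarTower k z E]

/-- the map `B(x,y) → E` induced by `ρ : B → E` for an algebra `E` over `Frac 𝔷[x,y]` -/
def specHom (ρ : B →ₐ[z] E) : F2 k ⊗[k] B →ₐ[k] E :=
  Algebra.TensorProduct.lift
    ((IsScalarTower.toAlgHom k (FractionRing (ZP2 z)) E).comp (fracMap k z))
    (ρ.restrictScalars k) fun _ _ => Algebra.commutes _ _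

variable {k} (ρ : B →ₐ[z] E)

lemma specHom_tmul (r : F2 k) (x : B) :
    specHom k ρ (r ⊗ₜ x) = fracMap k z r • ρ x :=
  (Algebra.smul_def _ _).symm

lemma specHom_RxElt (ωk : k) (x : B) (t : F2 k) :
    specHom k ρ (RxElt k ωk x t) = (1 - (fracMap k z t)⁻¹) • ρ x +
      ((fracMap k z t)⁻¹ * algebraMap k (FractionRing (ZP2 z)) ωk) • (1 : E) := by
  have h : ρ (algebraMap k B ωk) = algebraMap k (FractionRing (ZP2 z)) ωk • (1 : E) := by
    rw [IsScalarTower.algebraMap_apply k z B, AlgHom.commutes,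
      ← IsScalarTower.algebraMap_apply k z E, algebraMap_smul, Algebra.algebraMap_eq_smul_one]
  rw [RxElt, TensorProduct.smul_tmul', smul_eq_mul, mul_one, map_sub, specHom_tmul, specHom_tmul,
    map_one, map_inv₀, map_sub, h, one_smul, smul_sub, smul_smul, sub_smul, one_smul]
  abel

lemma specHom_iota_scalarHom [IsScalarTower z (FractionRing (ZP2 z)) E] (e : Fin 2)
    (s : RatFunc k ⊗[k] z) :
    specHom k ρ (iota k e (scalarHom k z s)) =
      algebraMap (FractionRing (ZP2 z)) E (scalarEval k z e s) := by
  induction s with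
  | zero => simp only [map_zero]
  | add s t hs ht => simp only [map_add, hs, ht]
  | tmul r a =>
    rw [scalarHom_tmul, scalarEval_tmul, iota, Algebra.TensorProduct.map_tmul, AlgHom.id_apply,
      specHom_tmul, AlgHom.commutes, map_mul, ← IsScalarTower.algebraMap_apply, Algebra.smul_def]

lemma specHom_iota_one_tmul (e : Fin 2) (x : B) :
    specHom k ρ (iota k e ((1 : RatFunc k) ⊗ₜ x)) = ρ x := by
  rw [iota, Algebra.TensorProduct.map_tmul, AlgHom.id_apply, specHom_tmul, map_one, map_one,
    one_smul]

end SpecializationHom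

section SpectralParameters

lemma xvar_ne_yvar : xvar k ≠ yvar k := fun h => by
  have := IsFractionRing.injective (P2 k) (F2 k) h
  simpa using MvPolynomial.X_injective this

lemma xvar_mul_yvar_ne_one : xvar k * yvar k ≠ 1 := fun h => by
  rw [xvar, yvar, ← map_mul, ← map_one (algebraMap (P2 k) (F2 k))] at h
  have := congrArg (MvPolynomial.eval 0) (IsFractionRing.injective (P2 k) (F2 k) h)
  simp at this

lemma xvar_ne_zero : xvar k ≠ 0 := by
  simp [xvar]

lemma yvar_ne_zero : yvar k ≠ 0 := by
  simp [yvar]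

end SpectralParameters

variable {k z ω} in
/-- For `n ≥ 4` the non-constant coefficients of a small solution vanish. -/
theorem coeff_eq_zero_of_isSol [IsDomain z] {q : k} (hq : q ≠ 0) (hw : q - q⁻¹ ≠ 0)
    (hω : ω = algebraMap k z (q - q⁻¹)) {n : ℕ} (hn : 4 ≤ n) {A : ℕ → z} {η : z}
    (hη : A n * η = 1) {f : ℕ → RatFunc k ⊗[k] z} {f' : RatFunc k ⊗[k] z}
    (hsol : IsSol k (q - q⁻¹) (Rp z ω n A) ((∑ i ∈ Finset.range (n - 1),
        scalarHom k z (f i) * ((1 : RatFunc k) ⊗ₜ[k] Kp z ω n A ^ i)) +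
          scalarHom k z f' * ((1 : RatFunc k) ⊗ₜ[k] KinvN z ω n A η))) :
    f' = 0 ∧ ∀ i, 1 ≤ i → i ≤ n - 2 → f i = 0 := by
  let W := FractionRing (ZP2 z)
  have hinj := (algebraMap k W).injective
  obtain ⟨E, _, _, R, K, K', hR, hRK, hK, hK', hkey⟩ :=
    exists_representation_small_coeff_eq_zero (W := W) (q := algebraMap k W q)
      ((map_ne_zero _).2 hq) (by rw [← map_inv₀, ← map_sub]; exact (map_ne_zero _).2 hw) hn
      (A := fun i => algebraMap z W (A i)) (η := algebraMap z W η)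
      (by rw [← map_mul, hη, map_one])
  let _ : Algebra z E := Algebra.compHom E (algebraMap z W)
  let _ : Algebra k E := Algebra.compHom E (algebraMap k W)
  have : IsScalarTower z W E := IsScalarTower.of_algebraMap_eq fun _ => rfl
  have : IsScalarTower k W E := IsScalarTower.of_algebraMap_eq fun _ => rfl
  have : IsScalarTower k z E := IsScalarTower.of_algebraMap_eq fun x => by
    rw [IsScalarTower.algebraMap_apply k W E, IsScalarTower.algebraMap_apply k z W,
      ← IsScalarTower.algebraMap_apply z W E]
  have hωW : algebraMap k W (q - q⁻¹) = algebraMap k W q - (algebraMap k W q)⁻¹ := by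
    rw [map_sub, map_inv₀]
  obtain ⟨ρ, hρR, hρK⟩ := exists_algHom_Hp (ω := ω) (n := n) (A := A) (R := R) (K := K)
    (by rw [hR, ← hωW, hω, IsScalarTower.algebraMap_apply k z W, algebraMap_smul]) hRK
    (by simpa only [algebraMap_smul] using hK)
  have hρK' : ρ (KinvN z ω n A η) = K' := by
    rw [KinvN, map_mul, AlgHom.commutes, ← Algebra.smul_def, hK', algebraMap_smul]
    simp only [map_sub, map_pow, map_sum, map_mul, AlgHom.commutes, hρK, Algebra.smul_def,
      IsScalarTower.algebraMap_apply z W E]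
  have hc : ∀ e, specHom k ρ (iota k e ((∑ i ∈ Finset.range (n - 1),
        scalarHom k z (f i) * ((1 : RatFunc k) ⊗ₜ[k] Kp z ω n A ^ i)) +
          scalarHom k z f' * ((1 : RatFunc k) ⊗ₜ[k] KinvN z ω n A η))) =
      smallElt K K' (scalarEval k z e f') (fun i => scalarEval k z e (f i)) (n - 2) := fun e => by
    rw [smallElt, show n - 2 + 1 = n - 1 by omega, add_comm]
    simp only [map_add, map_sum, map_mul, map_pow, specHom_iota_scalarHom, specHom_iota_one_tmul,
      hρK, hρK', Algebra.smul_def]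
  have h := congrArg (specHom k ρ) hsol
  simp only [map_mul] at h
  rw [hc, hc, specHom_RxElt, specHom_RxElt, hρR, hωW] at h
  have hfrac : ∀ t : F2 k, (fracMap k z t)⁻¹ = 1 → t = 1 := fun t ht =>
    (fracMap k z).toRingHom.injective (by
      simpa using inv_eq_one.1 ht)
  obtain ⟨h', hf⟩ := hkey _ _ _ _ _ _ (fun ha => xvar_ne_yvar k
      ((div_eq_one_iff_eq (yvar_ne_zero k)).1 (hfrac _ ha)))
    (inv_ne_zero ((map_ne_zero _).2 (mul_ne_zero (xvar_ne_zero k) (yvar_ne_zero k))))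
    (fun hb => xvar_mul_yvar_ne_one k (hfrac _ hb))
    (scalarEval_eq_zero_iff.trans scalarEval_eq_zero_iff.symm)
    (fun i => scalarEval_eq_zero_iff.trans scalarEval_eq_zero_iff.symm) h
  exact ⟨scalarEval_eq_zero_iff.1 h', fun i h₁ h₂ => scalarEval_eq_zero_iff.1 (hf i h₁ h₂)⟩

/-- Fix n ≥ 3, 𝔷 an integral domain and p(0) = Aₙ invertible. Every
non-trivial small solution of the reflection equation with spectral parameter has the form
a₊(x)K + a₀(x) + a₋(x)K⁻¹ with a₊, a₀, a₋ ∈ 𝔷(x); moreover such a solution can exist only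
when n = 3. -/
theorem small_solution_structure [CharZero k] [IsDomain z]
    (q : k) (hq0 : q ≠ 0) (hq1 : q ≠ 1) (hq1' : q ≠ -1)
    (hω : ω = algebraMap k z (q - q⁻¹))
    (n : ℕ) (hn : 3 ≤ n) (A : ℕ → z) (eta : z) (heta : A n * eta = 1) :
    ∀ c ∈ KpX k z ω n A,
      IsSol k (q - q⁻¹) (Rp z ω n A) c →
      ¬ IsScalarElt k z c →
      ¬ IsPrincipal k z ω n A c →
      (∃ ap a0 am : RatFunc k ⊗[k] Hp z ω n A,
        IsScalarElt k z ap ∧ IsScalarElt k z a0 ∧ IsScalarElt k z am ∧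
        c = ap * ((1 : RatFunc k) ⊗ₜ[k] Kp z ω n A) + a0 +
          am * ((1 : RatFunc k) ⊗ₜ[k] KinvN z ω n A eta)) ∧
      n = 3 := by
  intro c hc hsol hscalar hsmall
  obtain ⟨f, f', rfl⟩ := exists_small_expansion (by omega) heta hc hsmall
  rcases hn.eq_or_lt with rfl | hn
  · exact ⟨⟨scalarHom k z (f 1), scalarHom k z (f 0), scalarHom k z f',
      isScalarElt_scalarHom _, isScalarElt_scalarHom _, isScalarElt_scalarHom _, by
        simp [Finset.sum_range_succ, add_comm, ← Algebra.TensorProduct.one_def]⟩, rfl⟩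
  · refine (hscalar ?_).elim
    have hw : q - q⁻¹ ≠ 0 := by
      rw [sub_ne_zero, Ne, ← mul_eq_one_iff_eq_inv₀ hq0, mul_self_eq_one_iff]
      exact not_or.2 ⟨hq1, hq1'⟩
    obtain ⟨hf', hf⟩ := coeff_eq_zero_of_isSol hq0 hw hω hn heta hsol
    rw [hf', map_zero, zero_mul, add_zero, Finset.sum_eq_single 0]
    · rw [pow_zero, mul_one]
      exact isScalarElt_scalarHom _
    · intro i hi hi0
      have := Finset.mem_range.1 hi
      rw [hf i (by omega) (by omega), map_zero, zero_mul]
    · exact fun h => absurd (Finset.mem_range.2 (by omega)) h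

end Baxterization
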